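/- arXiv:1701.01460 — 2 statements merged into one kernel-verified Lean document; each statement's English description precedes it below -/
import Mathlib

section
/- Let u(t,·) be a Schwartz-class function of q ∈ ℝ^d for each t, smooth in t. Then there is a constant C depending only on d such that |t|^d ‖u(t,·)‖²_{L^∞(ℝ^d)} ≤ C Σ_{|α|+|β|=d} ‖W^α u(t,·)‖_{L²} ‖W^β u(t,·)‖_{L²}, where W^α = W_1^{α_1}⋯W_d^{α_d} and W_j = t∂_{q_j} + (i/2)q_j. -/
open MeasureTheory

/-- Spatial partial derivative ∂_{q_j} for functions of (t,q) ∈ ℝ × ℝ^d. -/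
noncomputable def dq (d : ℕ) (j : Fin d) (u : ℝ × (Fin d → ℝ) → ℂ) :
    ℝ × (Fin d → ℝ) → ℂ :=
  fun x => fderiv ℝ u x (0, Pi.single j 1)

/-- The Galilean boost operator W_j = t ∂_{q_j} + (i/2) q_j. -/
noncomputable def Wop (d : ℕ) (j : Fin d) (u : ℝ × (Fin d → ℝ) → ℂ) :
    ℝ × (Fin d → ℝ) → ℂ :=
  fun x => (x.1 : ℂ) * dq d j u x + (Complex.I / 2) * (x.2 j : ℂ) * u x

/-- Iterated operator W^α = W_1^{α_1} ⋯ W_d^{α_d} for a multiindex α. -/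
noncomputable def Wpow (d : ℕ) (α : Fin d → ℕ) (u : ℝ × (Fin d → ℝ) → ℂ) :
    ℝ × (Fin d → ℝ) → ℂ :=
  List.foldr (fun j f => (Wop d j)^[α j] f) u (List.finRange d)

open scoped SchwartzMap LineDeriv ENNReal Topology

namespace KS

lemma tg {d : ℕ} (j : Fin d) :
    Function.HasTemperateGrowth (fun q : Fin d → ℝ => (Complex.I / 2) * ((q j : ℝ) : ℂ)) := by
  have h := (((Complex.I / 2) • (Complex.ofRealCLM.comp
    (ContinuousLinearMap.proj (R := ℝ) (φ := fun _ : Fin d => ℝ) j)) :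
      (Fin d → ℝ) →L[ℝ] ℂ)).hasTemperateGrowth
  exact h

/-- The operator `W_j` at a fixed time, on Schwartz functions. -/
noncomputable def SW {d : ℕ} (t : ℝ) (j : Fin d) (f : 𝓢(Fin d → ℝ, ℂ)) : 𝓢(Fin d → ℝ, ℂ) :=
  (t : ℂ) • (∂_{(Pi.single j 1 : Fin d → ℝ)} f)
    + SchwartzMap.smulLeftCLM ℂ (fun q : Fin d → ℝ => (Complex.I / 2) * ((q j : ℝ) : ℂ)) f

lemma SW_apply {d : ℕ} (t : ℝ) (j : Fin d) (f : 𝓢(Fin d → ℝ, ℂ)) (q : Fin d → ℝ) :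
    SW t j f q = (t : ℂ) * fderiv ℝ f q (Pi.single j 1)
      + (Complex.I / 2) * (q j : ℂ) * f q := by
  simp [SW, SchwartzMap.lineDerivOp_apply_eq_fderiv, SchwartzMap.smulLeftCLM_apply_apply (tg j)]

noncomputable def SF {d : ℕ} (t : ℝ) (l : List (Fin d)) (α : Fin d → ℕ) (f : 𝓢(Fin d → ℝ, ℂ)) :
    𝓢(Fin d → ℝ, ℂ) :=
  List.foldr (fun j f => (SW t j)^[α j] f) f l

lemma SF_congr {d : ℕ} (t : ℝ) (l : List (Fin d)) (α β : Fin d → ℕ) (h : ∀ j ∈ l, α j = β j)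
    (f : 𝓢(Fin d → ℝ, ℂ)) : SF t l α f = SF t l β f := by
  induction l with
  | nil => rfl
  | cons j l ih =>
    have := ih (fun i hi => h i (List.mem_cons_of_mem _ hi))
    simp only [SF, List.foldr_cons] at this ⊢
    rw [this, h j (by simp)]

/-- relation: smooth and time slice equal to a given Schwartz function. -/
def Rel {d : ℕ} (t : ℝ) (u : ℝ × (Fin d → ℝ) → ℂ) (f : 𝓢(Fin d → ℝ, ℂ)) : Prop :=
  ContDiff ℝ (⊤ : ℕ∞) u ∧ ∀ q, u (t, q) = f q

lemma Rel.wop {d : ℕ} {t : ℝ} {u : ℝ × (Fin d → ℝ) → ℂ} {f : 𝓢(Fin d → ℝ, ℂ)}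
    (h : Rel t u f) (j : Fin d) : Rel t (Wop d j u) (SW t j f) := by
  obtain ⟨hu, hf⟩ := h
  constructor
  · have h1 : ContDiff ℝ (⊤ : ℕ∞) (dq d j u) := by
      unfold dq
      exact (hu.fderiv_right (m := (⊤ : ℕ∞)) (by simp)).clm_apply contDiff_const
    have h2 : ContDiff ℝ (⊤ : ℕ∞) (fun x : ℝ × (Fin d → ℝ) => (x.1 : ℂ)) :=
      Complex.ofRealCLM.contDiff.comp contDiff_fst
    have h3 : ContDiff ℝ (⊤ : ℕ∞) (fun x : ℝ × (Fin d → ℝ) => (x.2 j : ℂ)) :=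
      Complex.ofRealCLM.contDiff.comp ((contDiff_apply ℝ ℝ j).comp contDiff_snd)
    unfold Wop
    exact (h2.mul h1).add ((contDiff_const.mul h3).mul hu)
  · intro q
    rw [SW_apply]
    simp only [Wop, dq, hf]
    congr 2
    have hd : HasFDerivAt u (fderiv ℝ u (t, q)) (t, q) :=
      (hu.differentiable (by simp) (t, q)).hasFDerivAt
    have h1 := hd.comp q (hasFDerivAt_prodMk_right (𝕜 := ℝ) t q)
    have h2 : (u ∘ fun q => (t, q)) = f := by ext q; exact hf q
    rw [h2] at h1
    rw [h1.fderiv]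
    simp

lemma Rel.iter {d : ℕ} {t : ℝ} {u : ℝ × (Fin d → ℝ) → ℂ} {f : 𝓢(Fin d → ℝ, ℂ)}
    (h : Rel t u f) (j : Fin d) (n : ℕ) : Rel t ((Wop d j)^[n] u) ((SW t j)^[n] f) := by
  induction n with
  | zero => exact h
  | succ n ih =>
    rw [Function.iterate_succ_apply', Function.iterate_succ_apply']
    exact ih.wop j

lemma Rel.wpow {d : ℕ} {t : ℝ} {u : ℝ × (Fin d → ℝ) → ℂ} {f : 𝓢(Fin d → ℝ, ℂ)}
    (h : Rel t u f) (α : Fin d → ℕ) :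
    Rel t (Wpow d α u) (SF t (List.finRange d) α f) := by
  unfold Wpow SF
  generalize List.finRange d = l
  induction l with
  | nil => exact h
  | cons j l ih => exact ih.iter j _

lemma ftc (φ φ' : ℝ → ℂ) (hφ : ∀ s, HasDerivAt φ (φ' s) s) (hc : Continuous φ')
    (h0 : Filter.Tendsto φ Filter.atBot (𝓝 0)) (a : ℝ) :
    ‖φ a‖ₑ ≤ ∫⁻ s, ‖φ' s‖ₑ := by
  by_cases hfin : ∫⁻ s, ‖φ' s‖ₑ = ⊤
  · rw [hfin]; exact le_top
  have hi : Integrable φ' := ⟨hc.aestronglyMeasurable, lt_top_iff_ne_top.2 hfin⟩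
  have := integral_Iic_of_hasDerivAt_of_tendsto' (a := a) (fun x _ => hφ x) hi.integrableOn h0
  rw [sub_zero] at this
  rw [← this]
  exact (enorm_integral_le_lintegral_enorm _).trans (setLIntegral_le_lintegral _ _)

lemma step {d : ℕ} (t : ℝ) (j : Fin d) (f g : 𝓢(Fin d → ℝ, ℂ)) (q : Fin d → ℝ) :
    ‖t‖ₑ * (‖f q‖ₑ * ‖g q‖ₑ) ≤
      ∫⁻ s, (‖f (Function.update q j s)‖ₑ * ‖SW t j g (Function.update q j s)‖ₑ
        + ‖SW t j f (Function.update q j s)‖ₑ * ‖g (Function.update q j s)‖ₑ) := by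
  have hder : ∀ (h : 𝓢(Fin d → ℝ, ℂ)) (s : ℝ), HasDerivAt (fun s => h (Function.update q j s))
      (fderiv ℝ h (Function.update q j s) (Pi.single j 1)) s := fun h s =>
    (h.differentiableAt (x := Function.update q j s)).hasFDerivAt.comp_hasDerivAt s
      (hasDerivAt_update q j s)
  have hlim : ∀ (h : 𝓢(Fin d → ℝ, ℂ)),
      Filter.Tendsto (fun s => h (Function.update q j s)) Filter.atBot (𝓝 0) := fun h =>
    (h.tendsto_cocompact.comp (isClosedEmbedding_update q j).tendsto_cocompact).mono_left
      atBot_le_cocompact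
  have hcu : Continuous (fun s : ℝ => Function.update q j s) :=
    continuous_const.update j continuous_id
  set φ' : ℝ → ℂ := fun s => SW t j f (Function.update q j s) * star (g (Function.update q j s))
    + f (Function.update q j s) * star (SW t j g (Function.update q j s)) with hφ'
  have h1 := ftc (fun s => (t : ℂ) * (f (Function.update q j s) * star (g (Function.update q j s))))
    φ' ?_ ?_ ?_ (q j)
  · simp only [Function.update_eq_self, enorm_mul] at h1
    refine le_trans (le_of_eq ?_) (h1.trans (lintegral_mono fun s => ?_))
    · rw [show ‖star (g q)‖ₑ = ‖g q‖ₑ by simp [enorm_eq_nnnorm]]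
      congr 1
      simp [enorm_eq_nnnorm]
    · refine (enorm_add_le _ _).trans ?_
      rw [enorm_mul, enorm_mul, add_comm]
      simp [enorm_eq_nnnorm]
  · intro s
    have := ((hder f s).mul (hder g s).star).const_mul (t : ℂ)
    refine this.congr_deriv ?_
    simp only [hφ', SW_apply, Function.update_self]
    simp
    ring
  · have e1 := (SW t j f).continuous.comp hcu
    have e2 := (SW t j g).continuous.comp hcu
    have e3 := f.continuous.comp hcu
    have e4 := g.continuous.comp hcu
    exact (e1.mul e4.star).add (e3.mul e2.star)
  · have := (((hlim f).mul (hlim g).star)).const_mul (t : ℂ)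
    simpa using this

def ind {d : ℕ} (S : Finset (Fin d)) : Fin d → ℕ := fun i => if i ∈ S then 1 else 0
def ind' {d : ℕ} (S : Finset (Fin d)) : Fin d → ℕ := fun i => if i ∈ S then 0 else 1

lemma main {d : ℕ} (t : ℝ) (f g : 𝓢(Fin d → ℝ, ℂ)) (l : List (Fin d)) (hl : l.Nodup) :
    ∀ q, ‖t‖ₑ ^ l.length * (‖f q‖ₑ * ‖g q‖ₑ) ≤
      lmarginal (fun _ => volume) l.toFinset (fun q => ∑ S ∈ l.toFinset.powerset,
        ‖SF t l (ind S) f q‖ₑ * ‖SF t l (ind' S) g q‖ₑ) q := by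
  induction l with
  | nil => intro q; simp [SF]
  | cons j l ih =>
    intro q
    obtain ⟨hj, hl'⟩ := List.nodup_cons.1 hl
    have hj' : j ∉ l.toFinset := by simpa using hj
    have hm : ∀ (l l' : List (Fin d)) (T : Finset (Finset (Fin d))),
        Measurable (fun q => ∑ S ∈ T,
        ‖SF t l (ind S) f q‖ₑ * ‖SF t l' (ind' S) g q‖ₑ) := by
      intro l l' T
      refine Finset.measurable_sum _ fun S _ => ?_
      exact ((SF t l (ind S) f).continuous.measurable.enorm).mul
        ((SF t l' (ind' S) g).continuous.measurable.enorm)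
    rw [List.toFinset_cons, lmarginal_insert' _ (hm _ _ _) hj', List.length_cons, pow_succ',
      mul_assoc]
    refine (mul_le_mul_right (ih hl' q) _).trans ?_
    have hconst : ‖t‖ₑ * lmarginal (fun _ => volume) l.toFinset
        (fun q => ∑ S ∈ l.toFinset.powerset,
          ‖SF t l (ind S) f q‖ₑ * ‖SF t l (ind' S) g q‖ₑ) q
        = lmarginal (fun _ => volume) l.toFinset
        (fun q => ‖t‖ₑ * ∑ S ∈ l.toFinset.powerset,
          ‖SF t l (ind S) f q‖ₑ * ‖SF t l (ind' S) g q‖ₑ) q := by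
      unfold lmarginal
      rw [lintegral_const_mul]
      exact (hm _ _ _).comp measurable_updateFinset
    rw [hconst]
    refine lmarginal_mono (fun x => ?_) q
    simp only [Finset.mul_sum]
    refine (Finset.sum_le_sum fun S _ => step t j _ _ x).trans ?_
    rw [← lintegral_finsetSum]
    · refine lintegral_mono fun s => le_of_eq ?_
      rw [Finset.sum_powerset_insert hj', ← Finset.sum_add_distrib]
      refine Finset.sum_congr rfl fun S hS => ?_
      have hjS : j ∉ S := fun h => hj' (Finset.mem_powerset.1 hS h)
      have c1 : SF t (j :: l) (ind S) f = SF t l (ind S) f := by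
        simp [SF, ind, hjS]
      have c2 : SF t (j :: l) (ind' S) g = SW t j (SF t l (ind' S) g) := by
        simp [SF, ind', hjS]
      have hne : ∀ i ∈ l, i ≠ j := fun i hi h => hj (h ▸ hi)
      have c3 : SF t (j :: l) (ind (insert j S)) f = SW t j (SF t l (ind S) f) := by
        rw [SF_congr t l (ind S) (ind (insert j S)) (fun i hi => by simp [ind, hne i hi])]
        simp [SF, ind]
      have c4 : SF t (j :: l) (ind' (insert j S)) g = SF t l (ind' S) g := by
        rw [SF_congr t l (ind' S) (ind' (insert j S)) (fun i hi => by simp [ind', hne i hi])]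
        simp [SF, ind']
      rw [c1, c2, c3, c4]
    · intro S _
      have hcu : Measurable (fun s : ℝ => Function.update x j s) := measurable_update x
      have hh : ∀ h : 𝓢(Fin d → ℝ, ℂ), Measurable fun s : ℝ => ‖h (Function.update x j s)‖ₑ :=
        fun h => (h.continuous.measurable.comp hcu).enorm
      exact ((hh _).mul (hh _)).add ((hh _).mul (hh _))

lemma cs {d : ℕ} (f g : 𝓢(Fin d → ℝ, ℂ)) :
    ∫⁻ q, ‖f q‖ₑ * ‖g q‖ₑ ≤ eLpNorm f 2 volume * eLpNorm g 2 volume := by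
  have := ENNReal.lintegral_mul_le_Lp_mul_Lq (volume : Measure (Fin d → ℝ))
    Real.HolderConjugate.two_two
    (f.continuous.measurable.enorm.aemeasurable) (g.continuous.measurable.enorm.aemeasurable)
  rw [eLpNorm_eq_lintegral_rpow_enorm_toReal (by simp) (by simp),
    eLpNorm_eq_lintegral_rpow_enorm_toReal (by simp) (by simp)]
  simpa using this

lemma toReal_aux {ι : Type*} (d : ℕ) (t : ℝ) (z : ℂ) (T : Finset ι) (A B : ι → ℝ≥0∞)
    (hA : ∀ i, A i ≠ ⊤) (hB : ∀ i, B i ≠ ⊤)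
    (h : ‖t‖ₑ ^ d * (‖z‖ₑ * ‖z‖ₑ) ≤ ∑ i ∈ T, A i * B i) :
    |t| ^ d * ‖z‖ ^ 2 ≤ ∑ i ∈ T, (A i).toReal * (B i).toReal := by
  have hne : ∀ i ∈ T, A i * B i ≠ ⊤ := fun i _ => ENNReal.mul_ne_top (hA i) (hB i)
  have h3 := ENNReal.toReal_mono (ENNReal.sum_ne_top.2 hne) h
  rw [ENNReal.toReal_sum hne] at h3
  simpa [ENNReal.toReal_mul, pow_two] using h3

lemma ks_aux {d : ℕ} (t : ℝ) (f : 𝓢(Fin d → ℝ, ℂ)) (q : Fin d → ℝ) (l : List (Fin d))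
    (hl : l.Nodup) (hl' : l.toFinset = Finset.univ) (hd : l.length = d) :
    ‖t‖ₑ ^ d * (‖f q‖ₑ * ‖f q‖ₑ) ≤ ∑ S : Finset (Fin d),
      eLpNorm (SF t l (ind S) f) 2 volume * eLpNorm (SF t l (ind' S) f) 2 volume := by
  have h := main t f f l hl q
  rw [hl', lmarginal_univ, hd, ← volume_pi, Finset.powerset_univ] at h
  have hm : ∀ S ∈ (Finset.univ : Finset (Finset (Fin d))), Measurable (fun q =>
      ‖SF t l (ind S) f q‖ₑ * ‖SF t l (ind' S) f q‖ₑ) :=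
    fun S _ => ((SF t l (ind S) f).continuous.measurable.enorm).mul
        ((SF t l (ind' S) f).continuous.measurable.enorm)
  refine h.trans ?_
  rw [lintegral_finsetSum _ hm]
  exact Finset.sum_le_sum fun S _ => cs (SF t l (ind S) f) (SF t l (ind' S) f)

lemma ks {d : ℕ} (t : ℝ) (f : 𝓢(Fin d → ℝ, ℂ)) (q : Fin d → ℝ) :
    |t| ^ d * ‖f q‖ ^ 2 ≤ ∑ S : Finset (Fin d),
      (eLpNorm (SF t (List.finRange d) (ind S) f) 2 volume).toReal *
        (eLpNorm (SF t (List.finRange d) (ind' S) f) 2 volume).toReal := by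
  have hne : ∀ h : 𝓢(Fin d → ℝ, ℂ), eLpNorm h 2 (volume : Measure (Fin d → ℝ)) ≠ ⊤ := fun h =>
    (SchwartzMap.memLp h 2 (volume : Measure (Fin d → ℝ))).eLpNorm_ne_top
  exact toReal_aux d t (f q) _ _ _ (fun S => hne _) (fun S => hne _)
    (ks_aux t f q (List.finRange d) (List.nodup_finRange d) (List.toFinset_finRange d)
      List.length_finRange)

lemma ind_sum {d : ℕ} (S : Finset (Fin d)) : (∑ i, ind S i) + (∑ i, ind' S i) = d := by
  rw [← Finset.sum_add_distrib]
  have : ∀ i, ind S i + ind' S i = 1 := fun i => by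
    by_cases h : i ∈ S <;> simp [ind, ind', h]
  simp [this]

lemma fin_idx (d : ℕ) : Finite {ab : (Fin d → ℕ) × (Fin d → ℕ) //
    (∑ i, ab.1 i) + (∑ i, ab.2 i) = d} := by
  refine Set.Finite.to_subtype (s := {ab : (Fin d → ℕ) × (Fin d → ℕ) |
    (∑ i, ab.1 i) + (∑ i, ab.2 i) = d}) ?_
  refine ((Set.finite_Iic (fun _ : Fin d => d)).prod (Set.finite_Iic (fun _ : Fin d => d))).subset ?_
  rintro ⟨a, b⟩ h
  have h' : (∑ i, a i) + (∑ i, b i) = d := h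
  refine ⟨fun i => ?_, fun i => ?_⟩
  · have := Finset.single_le_sum (f := a) (fun _ _ => Nat.zero_le _) (Finset.mem_univ i)
    show a i ≤ d
    omega
  · have := Finset.single_le_sum (f := b) (fun _ _ => Nat.zero_le _) (Finset.mem_univ i)
    show b i ≤ d
    omega

end KS

/-- Klainerman–Sobolev inequality for the Schrödinger equation:
|t|^d ‖u(t,·)‖²_{L^∞} ≤ C Σ_{|α|+|β|=d} ‖W^α u(t,·)‖_{L²} ‖W^β u(t,·)‖_{L²},
with C depending only on d. -/
theorem stmt11 (d : ℕ) :
    ∃ C : ℝ, 0 < C ∧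
      ∀ u : ℝ × (Fin d → ℝ) → ℂ, ContDiff ℝ (⊤ : ℕ∞) u →
        (∀ t : ℝ, ∃ f : SchwartzMap (Fin d → ℝ) ℂ, ∀ q, u (t, q) = f q) →
        ∀ t : ℝ,
          |t| ^ d * (⨆ q : Fin d → ℝ, ‖u (t, q)‖) ^ 2
            ≤ C * ∑' ab : {ab : (Fin d → ℕ) × (Fin d → ℕ) //
                  (∑ i, ab.1 i) + (∑ i, ab.2 i) = d},
                (eLpNorm (fun q => Wpow d ab.1.1 u (t, q)) 2 volume).toReal
                  * (eLpNorm (fun q => Wpow d ab.1.2 u (t, q)) 2 volume).toReal := by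
  refine ⟨2 ^ d, by positivity, fun u hu hs t => ?_⟩
  obtain ⟨f, hf⟩ := hs t
  have hrel : KS.Rel t u f := ⟨hu, hf⟩
  have hW : ∀ α, (fun q => Wpow d α u (t, q)) = KS.SF t (List.finRange d) α f := fun α =>
    funext fun q => (hrel.wpow α).2 q
  simp only [hW]
  set F : {ab : (Fin d → ℕ) × (Fin d → ℕ) // (∑ i, ab.1 i) + (∑ i, ab.2 i) = d} → ℝ := fun ab =>
    (eLpNorm (KS.SF t (List.finRange d) ab.1.1 f) 2 volume).toReal *
      (eLpNorm (KS.SF t (List.finRange d) ab.1.2 f) 2 volume).toReal with hF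
  have := KS.fin_idx d
  have hF0 : ∀ ab, 0 ≤ F ab := fun ab => mul_nonneg ENNReal.toReal_nonneg ENNReal.toReal_nonneg
  have hsum : Summable F := summable_of_hasFiniteSupport (Set.toFinite _)
  have key : ∀ q, |t| ^ d * ‖u (t, q)‖ ^ 2 ≤ 2 ^ d * ∑' ab, F ab := by
    intro q
    rw [hf]
    refine (KS.ks t f q).trans ?_
    refine (Finset.sum_le_card_nsmul _ _ (∑' ab, F ab) fun S _ => ?_).trans (le_of_eq ?_)
    · exact hsum.le_tsum ⟨(KS.ind S, KS.ind' S), KS.ind_sum S⟩ (fun ab _ => hF0 ab)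
    · simp
  have hK : 0 ≤ 2 ^ d * ∑' ab, F ab := mul_nonneg (by positivity) (tsum_nonneg hF0)
  rcases (pow_nonneg (abs_nonneg t) d).eq_or_lt with h0 | h0
  · rw [← h0, zero_mul]; exact hK
  · have hM : (⨆ q : Fin d → ℝ, ‖u (t, q)‖) ≤ Real.sqrt ((2 ^ d * ∑' ab, F ab) / |t| ^ d) := by
      refine ciSup_le fun q => Real.le_sqrt_of_sq_le ?_
      rw [le_div_iff₀ h0, mul_comm]
      exact key q
    have hM0 : 0 ≤ (⨆ q : Fin d → ℝ, ‖u (t, q)‖) := Real.iSup_nonneg fun q => norm_nonneg _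
    have h2 := pow_le_pow_left₀ hM0 hM 2
    rw [Real.sq_sqrt (div_nonneg hK h0.le), le_div_iff₀ h0, mul_comm] at h2
    exact h2
end

section
/- Let u solve ∂_t u + iΔu = 0 with Schwartz data. Then |t|^d ‖u(t,·)‖²_{L^∞} ≤ C Σ_{|α|+|β|=d} ‖q^α u(0,·)‖_{L²} ‖q^β u(0,·)‖_{L²} for a constant C depending only on d, where q^α = q_1^{α_1}⋯q_d^{α_d}. -/
open MeasureTheory

/-- Time derivative ∂_t for functions of (t,q) ∈ ℝ × ℝ^d. -/
noncomputable def dt (d : ℕ) (u : ℝ × (Fin d → ℝ) → ℂ) : ℝ × (Fin d → ℝ) → ℂ :=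
  fun x => fderiv ℝ u x (1, 0)

section Helpers

section Part1
open MeasureTheory

open Complex in
/-- Gaussian Schroedinger kernel. -/
noncomputable def KK (d : ℕ) (z : ℂ) (x : Fin d → ℝ) : ℂ :=
  ((Real.pi : ℂ) / z) ^ ((d : ℂ) / 2) * cexp (-(∑ i, (x i : ℂ) ^ 2) / (4 * z))

theorem KK_norm (d : ℕ) (z : ℂ) (x : Fin d → ℝ) :
    ‖KK d z x‖ = (Real.pi / ‖z‖) ^ ((d : ℝ) / 2) *
      Real.exp (-(z.re / (4 * ‖z‖ ^ 2)) * ∑ i, x i ^ 2) := by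
  unfold KK
  rw [norm_mul, Complex.norm_exp]
  have h1 : ((d : ℂ) / 2) = (((d : ℝ) / 2 : ℝ) : ℂ) := by push_cast; rfl
  rw [h1, Complex.norm_cpow_real, norm_div, Complex.norm_real, Real.norm_of_nonneg Real.pi_pos.le]
  congr 2
  have h2 : (-(∑ i, (x i : ℂ) ^ 2) / (4 * z)) = ((-(∑ i, x i ^ 2) / 4 : ℝ) : ℂ) * z⁻¹ := by
    push_cast
    rw [div_eq_mul_inv, mul_inv]; ring
  rw [h2, Complex.re_ofReal_mul, Complex.inv_re, Complex.normSq_eq_norm_sq]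
  ring

theorem KK_norm_le (d : ℕ) {z : ℂ} {ε R : ℝ} (hε : 0 < ε) (hz : ε ≤ z.re) (hR : ‖z‖ ≤ R)
    (x : Fin d → ℝ) :
    ‖KK d z x‖ ≤ (Real.pi / ε) ^ ((d : ℝ) / 2) *
      Real.exp (-(ε / (4 * R ^ 2)) * ∑ i, x i ^ 2) := by
  rw [KK_norm]
  have hz' : ε ≤ ‖z‖ := hz.trans ((le_abs_self _).trans (Complex.abs_re_le_norm z))
  have hzp : 0 < ‖z‖ := hε.trans_le hz'
  have hS : 0 ≤ ∑ i, x i ^ 2 := Finset.sum_nonneg fun i _ => sq_nonneg _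
  have := Real.pi_pos
  have := hε.le.trans hz
  gcongr

theorem KK_norm_le' (d : ℕ) {z : ℂ} (hz : 0 < z.re) (x : Fin d → ℝ) :
    ‖KK d z x‖ ≤ (Real.pi / ‖z‖) ^ ((d : ℝ) / 2) := by
  rw [KK_norm]
  have hS : 0 ≤ ∑ i, x i ^ 2 := Finset.sum_nonneg fun i _ => sq_nonneg _
  have := Real.pi_pos
  refine mul_le_of_le_one_right (by positivity) (Real.exp_le_one_iff.2 ?_)
  have : 0 ≤ z.re / (4 * ‖z‖ ^ 2) := by positivity
  nlinarith

theorem gauss_integrable (d : ℕ) {c : ℝ} (hc : 0 < c) :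
    Integrable (fun x : Fin d → ℝ => Real.exp (-c * ∑ i, x i ^ 2)) := by
  have h := (GaussianFourier.integrable_cexp_neg_mul_sum_add (ι := Fin d) (b := (c : ℂ))
    (by simpa using hc) (fun _ => 0)).norm
  refine h.congr (Filter.Eventually.of_forall fun x => ?_)
  simp only [Complex.norm_exp]
  congr 1
  have : (-(c : ℂ) * ∑ i, (x i : ℂ) ^ 2 + ∑ i, 0 * (x i : ℂ)) =
    ((-c * ∑ i, x i ^ 2 : ℝ) : ℂ) := by push_cast; simp
  rw [this, Complex.ofReal_re]

theorem KK_continuous (d : ℕ) (z : ℂ) : Continuous (KK d z) := by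
  unfold KK; fun_prop

theorem KK_integrable (d : ℕ) {z : ℂ} (hz : 0 < z.re) : Integrable (KK d z) := by
  have hz' : 0 < ‖z‖ := norm_pos_iff.2 (by rintro rfl; simp at hz)
  refine Integrable.mono' ((gauss_integrable d (c := z.re / (4 * ‖z‖ ^ 2)) (by positivity)).const_mul
    ((Real.pi / ‖z‖) ^ ((d : ℝ) / 2))) (KK_continuous d z).aestronglyMeasurable ?_
  exact Filter.Eventually.of_forall fun x => (KK_norm d z x).le

theorem KK_sq_bound (d : ℕ) {z : ℂ} {ε R : ℝ} (hε : 0 < ε) (hz : ε ≤ z.re) (hR : ‖z‖ ≤ R)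
    (x : Fin d → ℝ) :
    (∑ i, x i ^ 2) * ‖KK d z x‖ ≤ (Real.pi / ε) ^ ((d : ℝ) / 2) * (8 * R ^ 2 / ε) *
      Real.exp (-(ε / (8 * R ^ 2)) * ∑ i, x i ^ 2) := by
  have hS : 0 ≤ ∑ i, x i ^ 2 := Finset.sum_nonneg fun i _ => sq_nonneg _
  have h := KK_norm_le d hε hz hR x
  set S := ∑ i, x i ^ 2
  have hz' : ε ≤ ‖z‖ := hz.trans ((le_abs_self _).trans (Complex.abs_re_le_norm z))
  have hRp : 0 < R := hε.trans_le (hz'.trans hR)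
  have hpi := Real.pi_pos
  set c := ε / (8 * R ^ 2) with hc
  have hcp : 0 < c := by positivity
  have e1 : -(ε / (4 * R ^ 2)) * S = -c * S + -(c * S) := by rw [hc]; field_simp; ring
  have e2 : 8 * R ^ 2 / ε = 1 / c := by rw [hc]; field_simp
  rw [e1, Real.exp_add] at h
  rw [e2]
  have h3 : c * S * Real.exp (-(c * S)) ≤ 1 := by
    have := Real.add_one_le_exp (c * S)
    rw [Real.exp_neg, ← div_eq_mul_inv, div_le_one (Real.exp_pos _)]
    linarith
  have h4 : S * Real.exp (-(c * S)) ≤ 1 / c := by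
    rw [le_div_iff₀ hcp]; linarith
  calc S * ‖KK d z x‖ ≤ S * ((Real.pi / ε) ^ ((d : ℝ) / 2) *
        (Real.exp (-c * S) * Real.exp (-(c * S)))) := by gcongr
    _ = (Real.pi / ε) ^ ((d : ℝ) / 2) * (S * Real.exp (-(c * S))) * Real.exp (-c * S) := by ring
    _ ≤ _ := by gcongr

/-- derivative in z -/
theorem KK_hasDerivAt (d : ℕ) {z : ℂ} (hz : 0 < z.re) (x : Fin d → ℝ) :
    HasDerivAt (fun w => KK d w x)
      ((-(d : ℂ) / (2 * z) + (∑ i, (x i : ℂ) ^ 2) / (4 * z ^ 2)) * KK d z x) z := by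
  have hz0 : z ≠ 0 := by rintro rfl; simp at hz
  have hpi : (Real.pi : ℂ) ≠ 0 := by exact_mod_cast Real.pi_ne_zero
  have h1 : HasDerivAt (fun w : ℂ => (Real.pi : ℂ) / w) (-(Real.pi : ℂ) / z ^ 2) z := by
    simpa using (hasDerivAt_const z (Real.pi : ℂ)).fun_div (hasDerivAt_id' z) hz0
  have hslit : (Real.pi : ℂ) / z ∈ Complex.slitPlane := by
    left
    rw [div_eq_mul_inv, Complex.re_ofReal_mul, Complex.inv_re]
    have := Complex.normSq_pos.2 hz0
    have := Real.pi_pos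
    positivity
  have h2 := h1.cpow_const (c := (d : ℂ) / 2) hslit
  have h3 : HasDerivAt (fun w : ℂ => -(∑ i, (x i : ℂ) ^ 2) / (4 * w))
      ((∑ i, (x i : ℂ) ^ 2) / (4 * z ^ 2)) z := by
    have := (hasDerivAt_const z (-(∑ i, (x i : ℂ) ^ 2))).fun_div ((hasDerivAt_id' z).const_mul 4)
      (by simpa using hz0)
    refine this.congr_deriv ?_
    field_simp
    ring
  have h4 := h2.mul h3.cexp
  refine h4.congr_deriv ?_
  unfold KK
  rw [Complex.cpow_sub _ _ (div_ne_zero hpi hz0), Complex.cpow_one]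
  field_simp

/-- first derivative in x -/
theorem KK_hasFDerivAt (d : ℕ) (z : ℂ) (x v : Fin d → ℝ) :
    HasLineDerivAt ℝ (KK d z) (-(∑ i, (x i : ℂ) * v i) / (2 * z) * KK d z x) x v := by
  unfold HasLineDerivAt
  have h1 : ∀ i, HasDerivAt (fun t : ℝ => (((x + t • v) i : ℝ) : ℂ) ^ 2) (2 * (x i : ℂ) * v i) 0 := by
    intro i
    have : HasDerivAt (fun t : ℝ => ((x + t • v) i : ℝ)) (v i) 0 := by
      simpa using ((hasDerivAt_id (0 : ℝ)).mul_const (v i)).const_add (x i)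
    have := this.ofReal_comp.fun_pow 2
    refine this.congr_deriv ?_
    simp
  have h2 := HasDerivAt.fun_sum (u := Finset.univ) fun i _ => h1 i
  have h3 := (((h2.fun_neg).div_const (4 * z)).cexp).const_mul (((Real.pi : ℂ) / z) ^ ((d : ℂ) / 2))
  refine h3.congr_deriv ?_
  unfold KK
  have h0 : x + (0 : ℝ) • v = x := by simp
  simp only [h0, mul_assoc, ← Finset.mul_sum]
  have : -(2 * ∑ i, (x i : ℂ) * v i) / (4 * z) = -(∑ i, (x i : ℂ) * v i) / (2 * z) := by
    rw [div_eq_mul_inv, div_eq_mul_inv, mul_inv, mul_inv]; ring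
  rw [this]; ring

/-- Fourier representation -/
theorem KK_eq_integral (d : ℕ) {z : ℂ} (hz : 0 < z.re) (x : Fin d → ℝ) :
    ∫ v : Fin d → ℝ, Complex.exp (-z * ∑ i, (v i : ℂ) ^ 2 + ∑ i, (Complex.I * x i) * v i) = KK d z x := by
  rw [GaussianFourier.integral_cexp_neg_mul_sum_add hz]
  unfold KK
  simp [mul_pow, Finset.sum_neg_distrib]

end Part1

section Part2
open MeasureTheory Filter Topology

theorem KK_one_int_ne (d : ℕ) : ∫ x, KK d 1 x ≠ 0 := by
  have h := GaussianFourier.integral_cexp_neg_mul_sum_add (ι := Fin d) (b := (1 / 4 : ℂ))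
    (by norm_num) (fun _ => 0)
  have hpi : (Real.pi : ℂ) ≠ 0 := by exact_mod_cast Real.pi_ne_zero
  have : ∀ x : Fin d → ℝ, KK d 1 x = ((Real.pi : ℂ) / 1) ^ ((d : ℂ) / 2) *
      Complex.exp (-(1 / 4 : ℂ) * ∑ i, (x i : ℂ) ^ 2 + ∑ i, 0 * (x i : ℂ)) := by
    intro x
    unfold KK
    congr 2
    simp; ring
  simp_rw [this]
  rw [integral_const_mul, h]
  simp only [ne_eq, mul_eq_zero, Complex.exp_ne_zero, or_false, Complex.cpow_eq_zero_iff]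
  simp [hpi]

theorem KK_scale (d : ℕ) {ε : ℝ} (hε : 0 < ε) (x : Fin d → ℝ) :
    ((Real.sqrt ε ^ d : ℝ) : ℂ) * KK d ε (Real.sqrt ε • x) = KK d 1 x := by
  unfold KK
  have hc : (ε : ℂ) ≠ 0 := by exact_mod_cast hε.ne'
  have hs : ((Real.sqrt ε : ℝ) : ℂ) ^ 2 = ε := by
    rw [← Complex.ofReal_pow, Real.sq_sqrt hε.le]
  have h1 : -(∑ i, (((Real.sqrt ε • x) i : ℝ) : ℂ) ^ 2) / (4 * (ε : ℂ)) =
      -(∑ i, (x i : ℂ) ^ 2) / (4 * 1) := by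
    simp only [Pi.smul_apply, smul_eq_mul, Complex.ofReal_mul, mul_pow, hs, ← Finset.mul_sum]
    field_simp
  rw [h1, ← mul_assoc]
  congr 1
  have e : (d : ℂ) / 2 = (((d : ℝ) / 2 : ℝ) : ℂ) := by push_cast; rfl
  rw [e, div_one, ← Complex.ofReal_div, ← Complex.ofReal_cpow (by positivity),
    ← Complex.ofReal_cpow Real.pi_pos.le, ← Complex.ofReal_mul]
  congr 1
  rw [Real.div_rpow Real.pi_pos.le hε.le]
  have : Real.sqrt ε ^ d = ε ^ ((d : ℝ) / 2) := by
    rw [Real.sqrt_eq_rpow, ← Real.rpow_natCast, ← Real.rpow_mul hε.le]; congr 1; ring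
  rw [this]
  field_simp

theorem conv_swap (d : ℕ) (f K : (Fin d → ℝ) → ℂ) (q0 : Fin d → ℝ) :
    ∫ q, f q * K (q0 - q) = ∫ y, f (q0 - y) * K y := by
  rw [← integral_sub_left_eq_self (fun q => f q * K (q0 - q)) volume q0]
  simp

theorem approx_id (d : ℕ) (f : (Fin d → ℝ) → ℂ) (hf : Continuous f) (B : ℝ)
    (hB : ∀ q, ‖f q‖ ≤ B) (q0 : Fin d → ℝ) :
    Tendsto (fun ε : ℝ => ∫ q, f q * KK d ε (q0 - q)) (𝓝[>] 0) (𝓝 (f q0 * ∫ x, KK d 1 x)) := by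
  have h1 : ∀ ε : ℝ, 0 < ε → ∫ q, f q * KK d ε (q0 - q) =
      ∫ x, f (q0 - Real.sqrt ε • x) * KK d 1 x := by
    intro ε hε
    rw [conv_swap]
    have h := Measure.integral_comp_smul (volume : Measure (Fin d → ℝ))
      (fun y => f (q0 - y) * KK d ε y) (Real.sqrt ε)
    have hs : 0 < Real.sqrt ε := Real.sqrt_pos.2 hε
    rw [Module.finrank_fin_fun, abs_of_pos (by positivity)] at h
    have h2 : ∫ x, f (q0 - Real.sqrt ε • x) * KK d 1 x =
        ((Real.sqrt ε ^ d : ℝ) : ℂ) * ∫ x, f (q0 - Real.sqrt ε • x) * KK d ε (Real.sqrt ε • x) := by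
      rw [← integral_const_mul]
      congr 1; ext x
      rw [← KK_scale d hε]; ring
    rw [h2, h, Complex.real_smul, ← mul_assoc, ← Complex.ofReal_mul, mul_inv_cancel₀ (by positivity)]
    simp
  have h2 : Tendsto (fun ε : ℝ => ∫ x, f (q0 - Real.sqrt ε • x) * KK d 1 x) (𝓝[>] 0)
      (𝓝 (∫ x, f q0 * KK d 1 x)) := by
    refine tendsto_integral_filter_of_dominated_convergence (fun x => B * ‖KK d 1 x‖) ?_ ?_ ?_ ?_
    · refine Eventually.of_forall fun ε => Continuous.aestronglyMeasurable ?_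
      have := KK_continuous d 1
      fun_prop
    · refine Eventually.of_forall fun ε => Eventually.of_forall fun x => ?_
      rw [norm_mul]
      gcongr
      exact hB _
    · exact ((KK_integrable d (z := 1) (by simp)).norm).const_mul B
    · refine Eventually.of_forall fun x => ?_
      have : Continuous fun ε : ℝ => f (q0 - Real.sqrt ε • x) * KK d 1 x := by fun_prop
      have := (this.tendsto 0).mono_left (nhdsWithin_le_nhds (s := Set.Ioi 0))
      simpa using this
  rw [integral_const_mul] at h2
  refine h2.congr' ?_
  filter_upwards [self_mem_nhdsWithin] with ε hε
  exact (h1 ε hε).symm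

/-- Fourier side: abstract bound by L1 norm of Fourier integral. -/
theorem fub (d : ℕ) (f : (Fin d → ℝ) → ℂ) (hf : Integrable f) {z : ℂ} (hz : 0 < z.re)
    (q0 : Fin d → ℝ)
    (hg : Integrable fun v : Fin d → ℝ => ∫ q, f q * Complex.exp (-Complex.I * ∑ i, (q i : ℂ) * v i)) :
    ‖∫ q, f q * KK d z (q0 - q)‖ ≤
      ∫ v : Fin d → ℝ, ‖∫ q, f q * Complex.exp (-Complex.I * ∑ i, (q i : ℂ) * v i)‖ := by
  have hG := GaussianFourier.integrable_cexp_neg_mul_sum_add (ι := Fin d) hz (fun _ => 0)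
  have hIntg : Integrable (fun p : (Fin d → ℝ) × (Fin d → ℝ) =>
      f p.1 * Complex.exp (-z * ∑ i, (p.2 i : ℂ) ^ 2 +
        ∑ i, (Complex.I * ((q0 - p.1) i : ℝ)) * p.2 i)) (volume.prod volume) := by
    have h := (hf.mul_prod hG)
    refine h.norm.mono' ?_ ?_
    · refine (hf.aestronglyMeasurable.comp_fst).mul (Continuous.aestronglyMeasurable ?_)
      simp only [Pi.sub_apply]
      fun_prop
    · refine Eventually.of_forall fun p => le_of_eq ?_
      rw [norm_mul, norm_mul, Complex.norm_exp, Complex.norm_exp]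
      congr 2
      have : ∑ i, Complex.I * (((q0 - p.1) i : ℝ) : ℂ) * (p.2 i : ℂ) =
          ((∑ i, (q0 - p.1) i * p.2 i : ℝ) : ℂ) * Complex.I := by
        push_cast; rw [Finset.sum_mul]; exact Finset.sum_congr rfl fun i _ => by ring
      rw [Complex.add_re, this, Complex.re_ofReal_mul]
      simp
  have h1 : ∫ q, f q * KK d z (q0 - q) = ∫ v : Fin d → ℝ,
      Complex.exp (-z * ∑ i, (v i : ℂ) ^ 2 + ∑ i, (Complex.I * q0 i) * v i) *
       ∫ q, f q * Complex.exp (-Complex.I * ∑ i, (q i : ℂ) * v i) := by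
    simp_rw [← KK_eq_integral d hz, ← integral_const_mul]
    rw [integral_integral_swap hIntg]
    congr 1; ext v; congr 1; ext q
    rw [mul_left_comm, ← Complex.exp_add]
    congr 2
    simp only [Pi.sub_apply, Complex.ofReal_sub, mul_sub, sub_mul, Finset.sum_sub_distrib,
      Finset.mul_sum, mul_assoc, neg_mul, Finset.sum_neg_distrib]
    ring
  rw [h1]
  refine (norm_integral_le_integral_norm _).trans ?_
  refine integral_mono_of_nonneg (Eventually.of_forall fun _ => norm_nonneg _) hg.norm
    (Eventually.of_forall fun v => ?_)
  simp only [norm_mul]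
  refine mul_le_of_le_one_left (norm_nonneg _) ?_
  rw [Complex.norm_exp, Real.exp_le_one_iff]
  have e1 : ∑ i, Complex.I * (q0 i : ℂ) * (v i : ℂ) =
      ((∑ i, q0 i * v i : ℝ) : ℂ) * Complex.I := by
    push_cast; rw [Finset.sum_mul]; exact Finset.sum_congr rfl fun i _ => by ring
  have e2 : (-z * ∑ i, (v i : ℂ) ^ 2) = ((-∑ i, v i ^ 2 : ℝ) : ℂ) * z := by push_cast; ring
  rw [Complex.add_re, e1, e2, Complex.re_ofReal_mul, Complex.re_ofReal_mul, Complex.I_re, mul_zero,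
    add_zero]
  have hS : 0 ≤ ∑ i, v i ^ 2 := Finset.sum_nonneg fun i _ => sq_nonneg _
  nlinarith

end Part2

section Part3
open MeasureTheory Filter Topology
open scoped SchwartzMap FourierTransform

/-- transfer to Euclidean space and Fourier transform -/
noncomputable def FE (d : ℕ) : 𝓢(Fin d → ℝ, ℂ) →L[ℝ] 𝓢(EuclideanSpace ℝ (Fin d), ℂ) :=
  (SchwartzMap.fourierTransformCLM ℝ).comp
    (SchwartzMap.compCLMOfContinuousLinearEquiv ℝ (EuclideanSpace.equiv (Fin d) ℝ))

theorem FE_apply (d : ℕ) (f : 𝓢(Fin d → ℝ, ℂ)) (v : Fin d → ℝ) :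
    ∫ q, f q * Complex.exp (-Complex.I * ∑ i, (q i : ℂ) * v i) =
      FE d f (WithLp.toLp 2 ((2 * Real.pi)⁻¹ • v)) := by
  have h1 : FE d f (WithLp.toLp 2 ((2 * Real.pi)⁻¹ • v)) =
    𝓕 (fun x : EuclideanSpace ℝ (Fin d) => f (WithLp.ofLp x)) (WithLp.toLp 2 ((2 * Real.pi)⁻¹ • v)) := rfl
  rw [h1, Real.fourier_eq']
  rw [← (PiLp.volume_preserving_toLp (Fin d)).integral_comp
    (MeasurableEquiv.toLp 2 _).measurableEmbedding]
  congr 1; ext q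
  rw [smul_eq_mul, mul_comm]
  congr 2
  simp [PiLp.inner_apply, Finset.mul_sum, Finset.sum_mul]
  refine Finset.sum_congr rfl fun i _ => ?_
  have : (Real.pi : ℂ) ≠ 0 := by exact_mod_cast Real.pi_ne_zero
  field_simp

theorem FE_L1 (d : ℕ) (f : 𝓢(Fin d → ℝ, ℂ)) :
    Integrable (fun v : Fin d → ℝ => ∫ q, f q * Complex.exp (-Complex.I * ∑ i, (q i : ℂ) * v i)) ∧
    ∫ v : Fin d → ℝ, ‖∫ q, f q * Complex.exp (-Complex.I * ∑ i, (q i : ℂ) * v i)‖ =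
      (2 * Real.pi) ^ d * ‖SchwartzMap.toLpCLM ℝ ℂ 1 volume (FE d f)‖ := by
  simp_rw [FE_apply]
  have hpi : (2 * Real.pi)⁻¹ ≠ 0 := by have := Real.pi_pos; positivity
  have hi : Integrable (fun v : Fin d → ℝ => FE d f (WithLp.toLp 2 v)) :=
    ((PiLp.volume_preserving_toLp (Fin d)).integrable_comp_emb
      (MeasurableEquiv.toLp 2 _).measurableEmbedding).2 (FE d f).integrable
  constructor
  · exact hi.comp_smul hpi
  · rw [Measure.integral_comp_smul volume (fun v : Fin d → ℝ => ‖FE d f (WithLp.toLp 2 v)‖)]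
    rw [SchwartzMap.toLpCLM_apply, SchwartzMap.norm_toLp_one,
      ← (PiLp.volume_preserving_toLp (Fin d)).integral_comp
      (MeasurableEquiv.toLp 2 _).measurableEmbedding]
    rw [Module.finrank_fin_fun, smul_eq_mul, inv_pow, inv_inv, abs_of_pos (by have := Real.pi_pos; positivity)]

theorem conv_bound (d : ℕ) (L : 𝓢(Fin d → ℝ, ℂ) →L[ℝ] 𝓢(Fin d → ℝ, ℂ)) :
    ∃ (N : ℕ) (C : ℝ), 0 ≤ C ∧ ∀ (f : 𝓢(Fin d → ℝ, ℂ)) (M : ℝ), 0 ≤ M →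
      (∀ k ≤ N, ∀ n ≤ N, ∀ x, ‖x‖ ^ k * ‖iteratedFDeriv ℝ n f x‖ ≤ M) →
      ∀ (z : ℂ), 0 < z.re → ∀ q0, ‖∫ q, L f q * KK d z (q0 - q)‖ ≤ C * M := by
  let T := (SchwartzMap.toLpCLM ℝ ℂ 1 (volume : Measure (EuclideanSpace ℝ (Fin d)))).comp ((FE d).comp L)
  obtain ⟨s, C, -, hC⟩ := Seminorm.bound_of_continuous
    (schwartz_withSeminorms ℝ (Fin d → ℝ) ℂ)
    ((normSeminorm ℝ _).comp T.toLinearMap) (continuous_norm.comp T.continuous)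
  refine ⟨s.sup (fun p => max p.1 p.2), (2 * Real.pi) ^ d * C, by have := Real.pi_pos; positivity, ?_⟩
  intro f M hM hf z hz q0
  obtain ⟨h1, h2⟩ := FE_L1 d (L f)
  refine (fub d (L f) (L f).integrable hz q0 h1).trans ?_
  rw [h2, mul_assoc]
  gcongr
  refine (hC f).trans ?_
  simp only [Seminorm.smul_apply]
  have : (s.sup (schwartzSeminormFamily ℝ (Fin d → ℝ) ℂ)) f ≤ M := by
    refine Seminorm.finset_sup_apply_le hM fun p hp => ?_
    refine SchwartzMap.seminorm_le_bound ℝ p.1 p.2 f hM ?_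
    have := Finset.le_sup (f := fun p : ℕ × ℕ => max p.1 p.2) hp
    exact hf _ ((le_max_left _ _).trans this) _ ((le_max_right _ _).trans this)
  rw [NNReal.smul_def, smul_eq_mul]
  gcongr

end Part3

section Part4
open MeasureTheory Filter Topology
open scoped SchwartzMap FourierTransform LineDeriv

theorem KK_sq_integrable (d : ℕ) {z : ℂ} (hz : 0 < z.re) :
    Integrable (fun x : Fin d → ℝ => (1 + ∑ i, x i ^ 2) * ‖KK d z x‖) := by
  have hz' : 0 < ‖z‖ := norm_pos_iff.2 (by rintro rfl; simp at hz)
  have h1 := (KK_integrable d hz).norm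
  have h2 : Integrable (fun x : Fin d → ℝ => (∑ i, x i ^ 2) * ‖KK d z x‖) := by
    refine Integrable.mono' ((gauss_integrable d (c := z.re / (8 * ‖z‖ ^ 2)) (by positivity)).const_mul
      ((Real.pi / z.re) ^ ((d : ℝ) / 2) * (8 * ‖z‖ ^ 2 / z.re))) ?_ ?_
    · have := KK_continuous d z
      exact Continuous.aestronglyMeasurable (by fun_prop)
    · refine Eventually.of_forall fun x => ?_
      have hS : 0 ≤ ∑ i, x i ^ 2 := Finset.sum_nonneg fun i _ => sq_nonneg _
      rw [Real.norm_of_nonneg (by positivity)]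
      exact KK_sq_bound d hz le_rfl le_rfl x
  refine (h1.add h2).congr (Eventually.of_forall fun x => ?_)
  simp; ring

theorem sol_int1 (d : ℕ) {z : ℂ} (hz : 0 < z.re) (f : (Fin d → ℝ) → ℂ) (hf : Continuous f) (B : ℝ)
    (hB : ∀ q, ‖f q‖ ≤ B) (q0 : Fin d → ℝ) (p : (Fin d → ℝ) → ℂ) (hp : Continuous p) (c : ℝ)
    (hpb : ∀ x, ‖p x‖ ≤ c * (1 + ∑ i, x i ^ 2)) :
    Integrable (fun q => f q * (p (q0 - q) * KK d z (q0 - q))) := by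
  have h0 : 0 ≤ B := (norm_nonneg _).trans (hB q0)
  have h1 := (((KK_sq_integrable d hz).comp_sub_left q0).const_mul c).const_mul B
  refine h1.mono' ?_ ?_
  · have := KK_continuous d z
    exact Continuous.aestronglyMeasurable (by fun_prop)
  · refine Eventually.of_forall fun q => ?_
    rw [norm_mul, norm_mul]
    have := hpb (q0 - q)
    have := hB q
    calc ‖f q‖ * (‖p (q0 - q)‖ * ‖KK d z (q0 - q)‖)
        ≤ B * ((c * (1 + ∑ i, (q0 - q) i ^ 2)) * ‖KK d z (q0 - q)‖) := by gcongr
      _ = _ := by ring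

theorem coord_le (d : ℕ) (x : Fin d → ℝ) (j : Fin d) : x j ^ 2 ≤ ∑ i, x i ^ 2 :=
  Finset.single_le_sum (f := fun i => x i ^ 2) (fun i _ => sq_nonneg _) (Finset.mem_univ j)

theorem schwartz_line (d : ℕ) (f : 𝓢(Fin d → ℝ, ℂ)) (v x : Fin d → ℝ) :
    HasLineDerivAt ℝ f (∂_{v} f x) x v := by
  rw [SchwartzMap.lineDerivOp_apply_eq_fderiv]
  exact (f.hasFDerivAt x).hasLineDerivAt v

theorem schwartz_bdd (d : ℕ) (f : 𝓢(Fin d → ℝ, ℂ)) : ∃ B, ∀ q, ‖f q‖ ≤ B :=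
  ⟨_, f.norm_le_seminorm ℝ⟩

theorem KK_line1 (d : ℕ) (z : ℂ) (q0 x : Fin d → ℝ) (j : Fin d) :
    HasLineDerivAt ℝ (fun q => KK d z (q0 - q))
      (((q0 - x) j : ℝ) / (2 * z) * KK d z (q0 - x)) x (Pi.single j 1) := by
  have h := KK_hasFDerivAt d z (q0 - x) (-Pi.single j 1)
  unfold HasLineDerivAt at h ⊢
  have e : (fun t : ℝ => KK d z (q0 - (x + t • Pi.single j 1))) =
    fun t : ℝ => KK d z (q0 - x + t • -Pi.single j 1) := by
    ext t; congr 1; rw [smul_neg]; abel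
  rw [e]
  refine h.congr_deriv ?_
  congr 2
  simp only [Pi.neg_apply, Complex.ofReal_neg, mul_neg, Finset.sum_neg_distrib, neg_neg]
  rw [Finset.sum_eq_single j]
  · simp
  · intro i _ hi; simp [hi]
  · simp

theorem KK_line2 (d : ℕ) (z : ℂ) (q0 x : Fin d → ℝ) (j : Fin d) :
    HasLineDerivAt ℝ (fun q => (((q0 - q) j : ℝ) : ℂ) / (2 * z) * KK d z (q0 - q))
      ((-1 / (2 * z) + (((q0 - x) j : ℝ) : ℂ) ^ 2 / (4 * z ^ 2)) * KK d z (q0 - x)) x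
      (Pi.single j 1) := by
  have h := KK_line1 d z q0 x j
  unfold HasLineDerivAt at h ⊢
  have h1 : HasDerivAt (fun t : ℝ => (((q0 - (x + t • (Pi.single j 1 : Fin d → ℝ))) j : ℝ) : ℂ) / (2 * z))
      (-1 / (2 * z)) 0 := by
    have : HasDerivAt (fun t : ℝ => ((q0 - (x + t • (Pi.single j 1 : Fin d → ℝ))) j : ℝ)) (-1) 0 := by
      simpa using ((hasDerivAt_id (0 : ℝ)).const_add (x j)).const_sub (q0 j)
    refine (this.ofReal_comp.div_const (2 * z)).congr_deriv ?_
    simp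
  refine (h1.fun_mul h).congr_deriv ?_
  have h0 : x + (0 : ℝ) • (Pi.single j 1 : Fin d → ℝ) = x := by simp
  rw [h0]
  rw [show (4 * z ^ 2) = (2 * z) * (2 * z) by ring]
  simp only [div_eq_mul_inv, mul_inv]
  ring

theorem KKi0 (d : ℕ) {z : ℂ} (hz : 0 < z.re) (g : 𝓢(Fin d → ℝ, ℂ)) (q0 : Fin d → ℝ) :
    Integrable (fun q => g q * KK d z (q0 - q)) := by
    obtain ⟨B, hB⟩ := schwartz_bdd d g
    have := sol_int1 d hz g g.continuous B hB q0 (fun _ => 1) (by fun_prop) 1 (fun x => by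
      have hS : 0 ≤ ∑ i, x i ^ 2 := Finset.sum_nonneg fun i _ => sq_nonneg _
      simpa using hS)
    simpa using this

theorem KKi2 (d : ℕ) {z : ℂ} (hz : 0 < z.re) (g : 𝓢(Fin d → ℝ, ℂ)) (q0 : Fin d → ℝ) (j : Fin d) :
    Integrable (fun q => g q *
      ((-1 / (2 * z) + (((q0 - q) j : ℝ) : ℂ) ^ 2 / (4 * z ^ 2)) * KK d z (q0 - q))) := by
    obtain ⟨B, hB⟩ := schwartz_bdd d g
    refine sol_int1 d hz g g.continuous B hB q0
      (fun x => (-1 / (2 * z) + ((x j : ℝ) : ℂ) ^ 2 / (4 * z ^ 2))) (by fun_prop)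
      (‖-1 / (2 * z)‖ + 1 / ‖4 * z ^ 2‖) (fun x => ?_)
    refine (norm_add_le _ _).trans ?_
    have hS : 0 ≤ ∑ i, x i ^ 2 := Finset.sum_nonneg fun i _ => sq_nonneg _
    rw [add_mul]
    gcongr
    · nlinarith [norm_nonneg (-1 / (2 * z))]
    · rw [norm_div, norm_pow, Complex.norm_real, Real.norm_eq_abs, sq_abs, one_div, inv_mul_eq_div]
      gcongr
      linarith [coord_le d x j]

theorem ibp (d : ℕ) {z : ℂ} (hz : 0 < z.re) (f : 𝓢(Fin d → ℝ, ℂ)) (q0 : Fin d → ℝ) (j : Fin d) :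
    ∫ q, (∂_{(Pi.single j 1 : Fin d → ℝ)} (∂_{(Pi.single j 1 : Fin d → ℝ)} f)) q * KK d z (q0 - q) =
    ∫ q, f q * ((-1 / (2 * z) + (((q0 - q) j : ℝ) : ℂ) ^ 2 / (4 * z ^ 2)) * KK d z (q0 - q)) := by
  have hc : ∀ x : Fin d → ℝ, |x j| ≤ 1 + ∑ i, x i ^ 2 := fun x => by
    have := coord_le d x j
    have := sq_nonneg (|x j| - 1)
    have := sq_abs (x j)
    nlinarith
  have A := fun g => KKi0 d hz g q0
  have A1 : ∀ g : 𝓢(Fin d → ℝ, ℂ), Integrable (fun q => g q * ((((q0 - q) j : ℝ) : ℂ) / (2 * z) * KK d z (q0 - q))) := fun g => by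
    obtain ⟨B, hB⟩ := schwartz_bdd d g
    refine sol_int1 d hz g g.continuous B hB q0 (fun x => ((x j : ℝ) : ℂ) / (2 * z)) (by fun_prop)
      (1 / ‖2 * z‖) (fun x => ?_)
    rw [norm_div, Complex.norm_real, Real.norm_eq_abs, one_div, inv_mul_eq_div]
    gcongr
    exact hc x
  have A2 := fun g => KKi2 d hz g q0 j
  obtain ⟨f1, hf1⟩ : ∃ f1 : 𝓢(Fin d → ℝ, ℂ), f1 = ∂_{(Pi.single j 1 : Fin d → ℝ)} f := ⟨_, rfl⟩
  obtain ⟨f2, hf2⟩ : ∃ f2 : 𝓢(Fin d → ℝ, ℂ), f2 = ∂_{(Pi.single j 1 : Fin d → ℝ)} f1 := ⟨_, rfl⟩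
  have d1 : ∀ x, HasLineDerivAt ℝ f (f1 x) x (Pi.single j 1) := by
    rw [hf1]; exact schwartz_line d f _
  have d2 : ∀ x, HasLineDerivAt ℝ f1 (f2 x) x (Pi.single j 1) := by
    rw [hf2]; exact schwartz_line d f1 _
  have i1 := integral_bilinear_hasLineDerivAt_right_eq_neg_left_of_integrable
    (μ := (volume : Measure (Fin d → ℝ))) (B := ContinuousLinearMap.mul ℝ ℂ)
    (f := f1) (f' := f2) (g := fun q => KK d z (q0 - q))
    (g' := fun q => (((q0 - q) j : ℝ) : ℂ) / (2 * z) * KK d z (q0 - q)) (v := Pi.single j 1)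
    (A f2) (A1 f1) (A f1)
    (fun x _ => d2 x) (fun x _ => KK_line1 d z q0 x j)
  have i2 := integral_bilinear_hasLineDerivAt_right_eq_neg_left_of_integrable
    (μ := (volume : Measure (Fin d → ℝ))) (B := ContinuousLinearMap.mul ℝ ℂ)
    (f := f) (f' := f1) (g := fun q => (((q0 - q) j : ℝ) : ℂ) / (2 * z) * KK d z (q0 - q))
    (g' := fun q => (-1 / (2 * z) + (((q0 - q) j : ℝ) : ℂ) ^ 2 / (4 * z ^ 2)) * KK d z (q0 - q))
    (v := Pi.single j 1)
    (A1 f1) (A2 f) (A1 f)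
    (fun x _ => d1 x) (fun x _ => KK_line2 d z q0 x j)
  simp only [ContinuousLinearMap.mul_apply'] at i1 i2
  rw [← hf1, ← hf2, i2, i1, neg_neg]

theorem conv_deriv (d : ℕ) (f : 𝓢(Fin d → ℝ, ℂ)) (K : (Fin d → ℝ) → ℂ) (hK : Integrable K)
    (v q0 : Fin d → ℝ) :
    HasDerivAt (fun t : ℝ => ∫ q, f q * K ((q0 + t • v) - q)) (∫ q, (∂_{v} f) q * K (q0 - q)) 0 := by
  simp_rw [conv_swap]
  obtain ⟨B, hB⟩ := schwartz_bdd d f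
  obtain ⟨B', hB'⟩ := schwartz_bdd d (∂_{v} f)
  have h := hasDerivAt_integral_of_dominated_loc_of_deriv_le (μ := (volume : Measure (Fin d → ℝ)))
    (F := fun (t : ℝ) y => f (q0 + t • v - y) * K y)
    (F' := fun (t : ℝ) y => (∂_{v} f) (q0 + t • v - y) * K y) (x₀ := 0) (s := Set.univ)
    (bound := fun y => B' * ‖K y‖) univ_mem ?_ ?_ ?_ ?_ ?_ ?_
  · simpa using h.2
  · refine Eventually.of_forall fun t => AEStronglyMeasurable.mul ?_ hK.aestronglyMeasurable
    exact Continuous.aestronglyMeasurable (by fun_prop)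
  · refine (hK.norm.const_mul B).mono' (AEStronglyMeasurable.mul ?_ hK.aestronglyMeasurable) ?_
    · exact Continuous.aestronglyMeasurable (by fun_prop)
    · refine Eventually.of_forall fun y => ?_
      rw [norm_mul]; gcongr; exact hB _
  · refine AEStronglyMeasurable.mul ?_ hK.aestronglyMeasurable
    exact Continuous.aestronglyMeasurable (by fun_prop)
  · refine Eventually.of_forall fun y t _ => ?_
    rw [norm_mul]; gcongr; exact hB' _
  · exact hK.norm.const_mul B'
  · refine Eventually.of_forall fun y t _ => ?_
    refine HasDerivAt.mul_const ?_ _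
    have := schwartz_line d f v (q0 + t • v - y)
    unfold HasLineDerivAt at this
    have h2 : HasDerivAt (fun s : ℝ => s - t) 1 t := (hasDerivAt_id t).sub_const t
    have h3 := HasDerivAt.scomp_of_eq (y := 0) t this h2 (by simp)
    rw [one_smul] at h3
    refine h3.congr_of_eventuallyEq (Eventually.of_forall fun s => ?_)
    simp only [Function.comp]
    congr 1
    rw [sub_smul]; abel

theorem conv_deriv_eq (d : ℕ) (f g : 𝓢(Fin d → ℝ, ℂ)) (K1 K2 : (Fin d → ℝ) → ℂ)
    (h1 : Integrable K1) (h2 : Integrable K2) (v : Fin d → ℝ)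
    (h : ∀ q0, ∫ q, f q * K1 (q0 - q) = ∫ q, g q * K2 (q0 - q)) (q0 : Fin d → ℝ) :
    ∫ q, (∂_{v} f) q * K1 (q0 - q) = ∫ q, (∂_{v} g) q * K2 (q0 - q) := by
  have a := conv_deriv d f K1 h1 v q0
  have b := conv_deriv d g K2 h2 v q0
  simp_rw [h] at a
  exact a.unique b

end Part4

section Part5
open MeasureTheory Filter Topology
open scoped SchwartzMap FourierTransform LineDeriv

structure IsSol (d : ℕ) (u : ℝ × (Fin d → ℝ) → ℂ) (F : ℝ → 𝓢(Fin d → ℝ, ℂ)) : Prop where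
  smooth : ContDiff ℝ (⊤ : ℕ∞) u
  slice : ∀ t q, u (t, q) = F t q
  pde : ∀ x : ℝ × (Fin d → ℝ), dt d u x + Complex.I * ∑ j : Fin d, dq d j (dq d j u) x = 0

theorem dq_smooth (d : ℕ) (j : Fin d) (u : ℝ × (Fin d → ℝ) → ℂ) (hu : ContDiff ℝ (⊤ : ℕ∞) u) :
    ContDiff ℝ (⊤ : ℕ∞) (dq d j u) := by
  unfold dq
  exact (hu.fderiv_right (m := (⊤ : ℕ∞)) (by simp)).clm_apply contDiff_const

theorem dq_slice (d : ℕ) (j : Fin d) (u : ℝ × (Fin d → ℝ) → ℂ) (hu : ContDiff ℝ (⊤ : ℕ∞) u)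
    (t : ℝ) (f : 𝓢(Fin d → ℝ, ℂ)) (h : ∀ q, u (t, q) = f q) (q : Fin d → ℝ) :
    dq d j u (t, q) = (∂_{(Pi.single j 1 : Fin d → ℝ)} f) q := by
  rw [SchwartzMap.lineDerivOp_apply_eq_fderiv]
  have h1 : (f : (Fin d → ℝ) → ℂ) = fun q => u (t, q) := by ext q; exact (h q).symm
  have h2 : HasFDerivAt u (fderiv ℝ u (t, q)) (t, q) :=
    (hu.differentiable (by simp) _).hasFDerivAt
  have h3 := h2.comp q (hasFDerivAt_prodMk_right (𝕜 := ℝ) t q)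
  have h4 : fderiv ℝ f q = (fderiv ℝ u (t, q)).comp (ContinuousLinearMap.inr ℝ ℝ (Fin d → ℝ)) := by
    rw [h1]; exact h3.fderiv
  rw [h4]
  simp [dq]

theorem dq2_slice {d : ℕ} {u : ℝ × (Fin d → ℝ) → ℂ} {F : ℝ → 𝓢(Fin d → ℝ, ℂ)} (h : IsSol d u F)
    (j : Fin d) (t : ℝ) (q : Fin d → ℝ) :
    dq d j (dq d j u) (t, q) =
      (∂_{(Pi.single j 1 : Fin d → ℝ)} (∂_{(Pi.single j 1 : Fin d → ℝ)} (F t))) q :=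
  dq_slice d j _ (dq_smooth d j u h.smooth) t _
    (fun q => dq_slice d j u h.smooth t _ (h.slice t) q) q

noncomputable def GG (d : ℕ) (u : ℝ × (Fin d → ℝ) → ℂ) (ε T : ℝ) (q0 : Fin d → ℝ) (s : ℝ) : ℂ :=
  ∫ q, u (s, q) * KK d (ε + Complex.I * (s - T)) (q0 - q)

theorem zre (ε a b : ℝ) : ((ε : ℂ) + Complex.I * ((a : ℂ) - b)).re = ε := by simp

theorem znorm (ε a b : ℝ) (hε : 0 < ε) : ‖(ε : ℂ) + Complex.I * ((a : ℂ) - b)‖ ≤ ε + |a - b| := by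
  refine (norm_add_le _ _).trans ?_
  rw [norm_mul, Complex.norm_I, one_mul, ← Complex.ofReal_sub, Complex.norm_real, Complex.norm_real,
    Real.norm_of_nonneg hε.le, Real.norm_eq_abs]

/-- bounded on all slices near t -/
def BddOn (d : ℕ) (u : ℝ × (Fin d → ℝ) → ℂ) (s : Set ℝ) : Prop :=
  ∃ B : ℝ, ∀ t ∈ s, ∀ q, ‖u (t, q)‖ ≤ B ∧ ∀ j, ‖dq d j (dq d j u) (t, q)‖ ≤ B

theorem GG_deriv {d : ℕ} {u : ℝ × (Fin d → ℝ) → ℂ} {F : ℝ → 𝓢(Fin d → ℝ, ℂ)} (h : IsSol d u F)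
    {t r : ℝ} (hr : 0 < r) (hb : BddOn d u (Metric.ball t r)) {ε : ℝ} (hε : 0 < ε) (T : ℝ)
    (q0 : Fin d → ℝ) : HasDerivAt (GG d u ε T q0) 0 t := by
  obtain ⟨B, hB⟩ := hb
  have hB0 : 0 ≤ B := (norm_nonneg _).trans (hB t (Metric.mem_ball_self hr) 0).1
  set R := ε + |t - T| + r with hR
  have hRp : 0 < R := by positivity
  set z : ℝ → ℂ := fun s => (ε : ℂ) + Complex.I * ((s : ℂ) - T) with hz
  have hzre : ∀ s, (z s).re = ε := fun s => zre ε s T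
  have hzR : ∀ s ∈ Metric.ball t r, ‖z s‖ ≤ R := by
    intro s hs
    refine (znorm ε s T hε).trans ?_
    rw [Metric.mem_ball, Real.dist_eq] at hs
    have : |s - T| ≤ |s - t| + |t - T| := abs_sub_le s t T
    linarith
  have hzε : ∀ s, ε ≤ ‖z s‖ := fun s =>
    (hzre s).ge.trans ((le_abs_self _).trans (Complex.abs_re_le_norm _))
  set P := (Real.pi / ε) ^ ((d : ℝ) / 2) with hP
  have hP0 : 0 ≤ P := by have := Real.pi_pos; positivity
  let F' : ℝ → (Fin d → ℝ) → ℂ := fun s q => dt d u (s, q) * KK d (z s) (q0 - q) +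
    u (s, q) * (((-(d : ℂ) / (2 * z s) + (∑ i, (((q0 - q) i : ℝ) : ℂ) ^ 2) / (4 * z s ^ 2)) *
      KK d (z s) (q0 - q)) * Complex.I)
  let E4 : (Fin d → ℝ) → ℝ := fun x => P * Real.exp (-(ε / (4 * R ^ 2)) * ∑ i, x i ^ 2)
  let E8 : (Fin d → ℝ) → ℝ := fun x => P * (8 * R ^ 2 / ε) * Real.exp (-(ε / (8 * R ^ 2)) * ∑ i, x i ^ 2)
  have iE4 : Integrable E4 := (gauss_integrable d (by positivity)).const_mul _
  have iE8 : Integrable E8 := (gauss_integrable d (by positivity)).const_mul _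
  have hucont : ∀ s, Continuous fun q => u (s, q) := fun s => by
    have := h.smooth.continuous; fun_prop
  have hdtcont : ∀ s, Continuous fun q => dt d u (s, q) := fun s => by
    have : Continuous (dt d u) := by
      unfold dt
      exact (h.smooth.continuous_fderiv (by simp)).clm_apply continuous_const
    fun_prop
  have hdt : ∀ x, dt d u x = -Complex.I * ∑ j : Fin d, dq d j (dq d j u) x := fun x => by
    have := h.pde x
    linear_combination this
  have key := hasDerivAt_integral_of_dominated_loc_of_deriv_le (μ := (volume : Measure (Fin d → ℝ)))
    (F := fun (s : ℝ) q => u (s, q) * KK d (z s) (q0 - q)) (F' := F') (x₀ := t)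
    (s := Metric.ball t r)
    (bound := fun q => (d * B) * E4 (q0 - q) + B * (d / (2 * ε) * E4 (q0 - q) +
      1 / (4 * ε ^ 2) * E8 (q0 - q))) (Metric.ball_mem_nhds t hr) ?_ ?_ ?_ ?_ ?_ ?_
  · have h0 : ∫ q, F' t q = 0 := by
      have hzt : 0 < (z t).re := by rw [hzre]; exact hε
      have e : ∀ q, F' t q = ∑ j : Fin d, (-Complex.I) *
          ((∂_{(Pi.single j 1 : Fin d → ℝ)} (∂_{(Pi.single j 1 : Fin d → ℝ)} (F t))) q *
            KK d (z t) (q0 - q) - F t q *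
            ((-1 / (2 * z t) + (((q0 - q) j : ℝ) : ℂ) ^ 2 / (4 * z t ^ 2)) * KK d (z t) (q0 - q))) := by
        intro q
        simp only [F']
        rw [hdt, h.slice]
        simp_rw [dq2_slice h]
        rw [← Finset.mul_sum, Finset.sum_sub_distrib, ← Finset.sum_mul, ← Finset.mul_sum,
          ← Finset.sum_mul, Finset.sum_add_distrib, Finset.sum_const, ← Finset.sum_div]
        simp only [Finset.card_univ, Fintype.card_fin, nsmul_eq_mul]
        ring
      simp_rw [e]
      rw [integral_finsetSum]
      · refine Finset.sum_eq_zero fun j _ => ?_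
        rw [integral_const_mul, integral_sub (KKi0 d hzt _ q0) (KKi2 d hzt _ q0 j), ibp d hzt]
        simp
      · intro j _
        exact ((KKi0 d hzt _ q0).sub (KKi2 d hzt _ q0 j)).const_mul _
    rw [h0] at key
    exact key.2
  · refine Eventually.of_forall fun s => Continuous.aestronglyMeasurable ?_
    exact (hucont s).mul ((KK_continuous d (z s)).comp (continuous_const.sub continuous_id))
  · simp_rw [h.slice]
    exact KKi0 d (by rw [hzre]; exact hε) _ q0
  · have c1 : Continuous fun q => KK d (z t) (q0 - q) :=
      (KK_continuous d (z t)).comp (continuous_const.sub continuous_id)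
    refine Continuous.aestronglyMeasurable ?_
    simp only [F', Pi.sub_apply]
    refine ((hdtcont t).mul c1).add ((hucont t).mul ((Continuous.mul ?_ c1).mul continuous_const))
    fun_prop
  · refine Eventually.of_forall fun q s hs => ?_
    have k4 : ‖KK d (z s) (q0 - q)‖ ≤ E4 (q0 - q) := KK_norm_le d hε (hzre s).ge (hzR s hs) _
    have k8 : (∑ i, (q0 - q) i ^ 2) * ‖KK d (z s) (q0 - q)‖ ≤ E8 (q0 - q) :=
      KK_sq_bound d hε (hzre s).ge (hzR s hs) _
    have hS : 0 ≤ ∑ i, (q0 - q) i ^ 2 := Finset.sum_nonneg fun i _ => sq_nonneg _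
    have kd : ‖dt d u (s, q)‖ ≤ d * B := by
      rw [hdt, norm_mul, norm_neg, Complex.norm_I, one_mul]
      refine (norm_sum_le _ _).trans ?_
      refine (Finset.sum_le_sum fun j _ => (hB s hs q).2 j).trans ?_
      simp
    have kz := hzε s
    simp only [F']
    refine (norm_add_le _ _).trans (add_le_add ?_ ?_)
    · rw [norm_mul]; gcongr
    · rw [norm_mul, norm_mul, Complex.norm_I, mul_one, norm_mul]
      refine mul_le_mul (hB s hs q).1 ?_ (by positivity) hB0
      have n1 : ‖-(d : ℂ) / (2 * z s)‖ ≤ d / (2 * ε) := by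
        rw [norm_div, norm_neg, norm_mul]
        simp only [Complex.norm_natCast, Complex.norm_ofNat]
        gcongr
      have n2 : ‖(∑ i, (((q0 - q) i : ℝ) : ℂ) ^ 2) / (4 * z s ^ 2)‖ ≤
          1 / (4 * ε ^ 2) * ∑ i, (q0 - q) i ^ 2 := by
        have : (∑ i, (((q0 - q) i : ℝ) : ℂ) ^ 2) = ((∑ i, (q0 - q) i ^ 2 : ℝ) : ℂ) := by push_cast; rfl
        rw [this, norm_div, Complex.norm_real, Real.norm_of_nonneg hS, norm_mul, norm_pow,
          Complex.norm_ofNat, one_div, inv_mul_eq_div]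
        gcongr
      calc _ ≤ (d / (2 * ε) + 1 / (4 * ε ^ 2) * ∑ i, (q0 - q) i ^ 2) * ‖KK d (z s) (q0 - q)‖ := by
            gcongr
            exact (norm_add_le _ _).trans (add_le_add n1 n2)
        _ = d / (2 * ε) * ‖KK d (z s) (q0 - q)‖ +
            1 / (4 * ε ^ 2) * ((∑ i, (q0 - q) i ^ 2) * ‖KK d (z s) (q0 - q)‖) := by ring
        _ ≤ _ := by gcongr
  · have i4 := iE4.comp_sub_left q0
    have i8 := iE8.comp_sub_left q0
    exact (i4.const_mul _).add (((i4.const_mul _).add (i8.const_mul _)).const_mul _)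
  · refine Eventually.of_forall fun q s hs => ?_
    have d1 : HasDerivAt (fun s => u (s, q)) (dt d u (s, q)) s := by
      have h2 : HasFDerivAt u (fderiv ℝ u (s, q)) (s, q) :=
        (h.smooth.differentiable (by simp) _).hasFDerivAt
      have h3 := (h2.comp s (hasFDerivAt_prodMk_left (𝕜 := ℝ) s q)).hasDerivAt
      have h4 : HasDerivAt (fun s => u (s, q)) _ s := h3
      convert h4 using 1
      simp [dt]
    have d2 : HasDerivAt z Complex.I s := by
      have := (((hasDerivAt_id s).ofReal_comp.sub_const (T : ℂ)).const_mul Complex.I).const_add (ε : ℂ)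
      have h5 : HasDerivAt z _ s := this
      convert h5 using 1
      simp
    have d3 := (KK_hasDerivAt d (z := z s) (by rw [hzre]; exact hε) (q0 - q)).comp s d2
    exact d1.mul d3

end Part5

section Part6
open MeasureTheory Filter Topology
open scoped SchwartzMap FourierTransform LineDeriv

theorem lim_bound (d : ℕ) (f : 𝓢(Fin d → ℝ, ℂ)) (q0 : Fin d → ℝ) (X : ℝ)
    (h : ∀ ε : ℝ, 0 < ε → ‖∫ q, f q * KK d ε (q0 - q)‖ ≤ X) :
    ‖f q0‖ * ‖∫ x, KK d 1 x‖ ≤ X := by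
  obtain ⟨B, hB⟩ := schwartz_bdd d f
  have h1 := (approx_id d f f.continuous B hB q0).norm
  rw [norm_mul] at h1
  refine le_of_tendsto h1 ?_
  filter_upwards [self_mem_nhdsWithin] with ε hε using h ε hε

def Geq (d : ℕ) (u : ℝ × (Fin d → ℝ) → ℂ) (t s : ℝ) : Prop :=
  ∀ ε : ℝ, 0 < ε → ∀ q0, GG d u ε t q0 s = GG d u ε t q0 t

theorem Geq_refl (d : ℕ) (u : ℝ × (Fin d → ℝ) → ℂ) (t : ℝ) : Geq d u t t := fun _ _ _ => rfl

theorem Geq_slice {d : ℕ} {u : ℝ × (Fin d → ℝ) → ℂ} {F : ℝ → 𝓢(Fin d → ℝ, ℂ)} (h : IsSol d u F)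
    {t s : ℝ} (hg : Geq d u t s) {ε : ℝ} (hε : 0 < ε) (q0 : Fin d → ℝ) :
    ∫ q, F t q * KK d ε (q0 - q) =
      ∫ q, F s q * KK d ((ε : ℂ) + Complex.I * ((s : ℂ) - t)) (q0 - q) := by
  have := hg ε hε q0
  unfold GG at this
  simp_rw [h.slice] at this
  rw [this]
  simp

theorem L3a (d : ℕ) : ∃ (N : ℕ) (C : ℝ), 0 ≤ C ∧ ∀ (u : ℝ × (Fin d → ℝ) → ℂ)
    (F : ℝ → 𝓢(Fin d → ℝ, ℂ)), IsSol d u F → ∀ (t s M : ℝ), 0 ≤ M → Geq d u t s →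
    (∀ k ≤ N, ∀ n ≤ N, ∀ x, ‖x‖ ^ k * ‖iteratedFDeriv ℝ n (F s) x‖ ≤ M) →
    ∀ q, ‖u (t, q)‖ ≤ C * M ∧ ∀ j, ‖dq d j (dq d j u) (t, q)‖ ≤ C * M := by
  obtain ⟨N0, C0, hC0, h0⟩ := conv_bound d (ContinuousLinearMap.id ℝ _)
  have hj := fun j : Fin d => conv_bound d
    ((LineDeriv.lineDerivOpCLM ℝ 𝓢(Fin d → ℝ, ℂ) (Pi.single j 1 : Fin d → ℝ)).comp
      (LineDeriv.lineDerivOpCLM ℝ 𝓢(Fin d → ℝ, ℂ) (Pi.single j 1 : Fin d → ℝ)))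
  choose Nj Cj hCj hj using hj
  set c := ‖∫ x, KK d 1 x‖ with hc
  have hcp : 0 < c := norm_pos_iff.mpr (KK_one_int_ne d)
  have hS : 0 ≤ ∑ j, Cj j := Finset.sum_nonneg fun j _ => hCj j
  refine ⟨N0 + ∑ j, Nj j, (C0 + ∑ j, Cj j) / c, by positivity, ?_⟩
  intro u F h t s M hM hg hb q
  constructor
  · rw [h.slice, div_mul_eq_mul_div, le_div_iff₀ hcp]
    refine (lim_bound d (F t) q (C0 * M) fun ε hε => ?_).trans (by gcongr; linarith)
    rw [Geq_slice h hg hε]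
    exact h0 (F s) M hM (fun k hk n hn x => hb k (by omega) n (by omega) x) _
      (by rw [zre]; exact hε) q
  · intro j
    have hNj : Nj j ≤ ∑ j, Nj j := Finset.single_le_sum (fun i _ => Nat.zero_le (Nj i)) (Finset.mem_univ j)
    have hCj' : Cj j ≤ ∑ j, Cj j := Finset.single_le_sum (fun i _ => hCj i) (Finset.mem_univ j)
    rw [dq2_slice h, div_mul_eq_mul_div, le_div_iff₀ hcp]
    refine (lim_bound d _ q (Cj j * M) fun ε hε => ?_).trans (by gcongr; linarith)
    have i1 : Integrable (KK d (ε : ℂ)) := KK_integrable d (by simpa using hε)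
    have i2 : Integrable (KK d ((ε : ℂ) + Complex.I * ((s : ℂ) - t))) :=
      KK_integrable d (by rw [zre]; exact hε)
    rw [conv_deriv_eq d _ _ _ _ i1 i2 _ (fun q0 => conv_deriv_eq d _ _ _ _ i1 i2
      (Pi.single j 1 : Fin d → ℝ) (fun q1 => Geq_slice h hg hε q1) q0)]
    exact hj j (F s) M hM (fun k hk n hn x => hb k (by omega) n (by omega) x) _
      (by rw [zre]; exact hε) q

theorem L3b {d : ℕ} {u : ℝ × (Fin d → ℝ) → ℂ} {F : ℝ → 𝓢(Fin d → ℝ, ℂ)} (h : IsSol d u F)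
    {t s : ℝ} (hg : Geq d u t s) (hts : s ≠ t ∨ d = 0) (q0 : Fin d → ℝ) :
    ‖u (t, q0)‖ * ‖∫ x, KK d 1 x‖ ≤ (Real.pi / |s - t|) ^ ((d : ℝ) / 2) * ∫ q, ‖u (s, q)‖ := by
  rw [h.slice]
  refine lim_bound d (F t) q0 _ fun ε hε => ?_
  rw [Geq_slice h hg hε]
  simp_rw [h.slice]
  rw [← integral_const_mul]
  refine (norm_integral_le_integral_norm _).trans ?_
  refine integral_mono (KKi0 d (by rw [zre]; exact hε) _ q0).norm
    ((F s).integrable.norm.const_mul _) fun q => ?_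
  simp only
  rw [norm_mul, mul_comm]
  refine mul_le_mul_of_nonneg_right ?_ (norm_nonneg _)
  refine (KK_norm_le' d (by rw [zre]; exact hε) _).trans ?_
  rcases hts with hts | hd
  · have h1 : |s - t| ≤ ‖(ε : ℂ) + Complex.I * ((s : ℂ) - t)‖ := by
      have := Complex.abs_im_le_norm ((ε : ℂ) + Complex.I * ((s : ℂ) - t))
      simpa using this
    have h2 : 0 < |s - t| := abs_pos.mpr (sub_ne_zero.mpr hts)
    have := Real.pi_pos
    gcongr
  · subst hd; simp

theorem GG_cont {d : ℕ} {u : ℝ × (Fin d → ℝ) → ℂ} {F : ℝ → 𝓢(Fin d → ℝ, ℂ)} (h : IsSol d u F)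
    {t r B : ℝ} (hB : ∀ s ∈ Metric.ball t r, ∀ q, ‖u (s, q)‖ ≤ B) {ε : ℝ} (hε : 0 < ε) (T : ℝ)
    (q0 : Fin d → ℝ) (a : ℝ) :
    Tendsto (GG d u ε T q0) (𝓝[Metric.ball t r] a) (𝓝 (GG d u ε T q0 a)) := by
  set R := ε + |t - T| + |r| with hR
  have hRp : 0 < R := by positivity
  have hzR : ∀ s ∈ Metric.ball t r, ‖(ε : ℂ) + Complex.I * ((s : ℂ) - T)‖ ≤ R := by
    intro s hs
    refine (znorm ε s T hε).trans ?_
    rw [Metric.mem_ball, Real.dist_eq] at hs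
    have : |s - T| ≤ |s - t| + |t - T| := abs_sub_le s t T
    have := le_abs_self r
    linarith
  unfold GG
  refine tendsto_integral_filter_of_dominated_convergence
    (fun q => B * ((Real.pi / ε) ^ ((d : ℝ) / 2) *
      Real.exp (-(ε / (4 * R ^ 2)) * ∑ i, (q0 - q) i ^ 2))) ?_ ?_ ?_ ?_
  · refine Eventually.of_forall fun s => ?_
    simp_rw [h.slice]
    exact (KKi0 d (by rw [zre]; exact hε) _ q0).aestronglyMeasurable
  · filter_upwards [self_mem_nhdsWithin] with s hs
    refine Eventually.of_forall fun q => ?_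
    rw [norm_mul]
    refine mul_le_mul (hB s hs q) (KK_norm_le d hε (zre ε s T).ge (hzR s hs) _) (norm_nonneg _)
      ((norm_nonneg _).trans (hB s hs q))
  · exact (((gauss_integrable d (c := ε / (4 * R ^ 2)) (by positivity)).const_mul _).comp_sub_left q0).const_mul _
  · refine Eventually.of_forall fun q => ?_
    refine Tendsto.mono_left ?_ nhdsWithin_le_nhds
    refine Tendsto.mul ?_ ?_
    · have := h.smooth.continuous
      have c : Continuous fun s : ℝ => u (s, q) := by fun_prop
      exact c.tendsto a
    · have d3 := (KK_hasDerivAt d (z := (ε : ℂ) + Complex.I * ((a : ℂ) - T)) (by rw [zre]; exact hε) (q0 - q)).continuousAt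
      have c : Continuous fun s : ℝ => (ε : ℂ) + Complex.I * ((s : ℂ) - T) := by fun_prop
      exact d3.tendsto.comp (c.tendsto a)

def OO (d : ℕ) (u : ℝ × (Fin d → ℝ) → ℂ) : Set ℝ := {t | ∃ r > 0, BddOn d u (Metric.ball t r)}

theorem OO_open (d : ℕ) (u : ℝ × (Fin d → ℝ) → ℂ) : IsOpen (OO d u) := by
  rw [Metric.isOpen_iff]
  rintro t ⟨r, hr, B, hB⟩
  refine ⟨r, hr, fun s hs => ?_⟩
  obtain ⟨δ, hδ, hsub⟩ := Metric.isOpen_iff.mp Metric.isOpen_ball s hs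
  exact ⟨δ, hδ, B, fun x hx => hB x (hsub hx)⟩

theorem GG_const {d : ℕ} {u : ℝ × (Fin d → ℝ) → ℂ} {F : ℝ → 𝓢(Fin d → ℝ, ℂ)} (h : IsSol d u F)
    {t r : ℝ} (hO : Metric.ball t r ⊆ OO d u) {a b : ℝ} (ha : a ∈ Metric.ball t r)
    (hb : b ∈ Metric.ball t r) {ε : ℝ} (hε : 0 < ε) (T : ℝ) (q0 : Fin d → ℝ) :
    GG d u ε T q0 a = GG d u ε T q0 b := by
  have hd : ∀ x ∈ Metric.ball t r, HasDerivAt (GG d u ε T q0) 0 x := fun x hx => by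
    obtain ⟨r, hr, hb⟩ := hO hx
    exact GG_deriv h hr hb hε T q0
  exact (convex_ball t r).is_const_of_fderivWithin_eq_zero (𝕜 := ℝ)
    (fun x hx => (hd x hx).differentiableAt.differentiableWithinAt)
    (fun x hx => by
      rw [fderivWithin_of_isOpen Metric.isOpen_ball hx]
      have := (hd x hx).hasFDerivAt.fderiv
      rw [this]; ext; simp) ha hb

theorem sch_bd (d N : ℕ) (f : 𝓢(Fin d → ℝ, ℂ)) : ∃ M : ℕ,
    ∀ k ≤ N, ∀ n ≤ N, ∀ x, ‖x‖ ^ k * ‖iteratedFDeriv ℝ n f x‖ ≤ M := by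
  choose C hC using fun k n => f.decay' k n
  obtain ⟨M, hM⟩ := exists_nat_ge (∑ k ∈ Finset.range (N+1), ∑ n ∈ Finset.range (N+1), |C k n|)
  refine ⟨M, fun k hk n hn x => (hC k n x).trans ((le_abs_self _).trans (le_trans ?_ hM))⟩
  refine le_trans ?_ (Finset.single_le_sum (f := fun k => ∑ n ∈ Finset.range (N+1), |C k n|)
    (fun i _ => Finset.sum_nonneg fun _ _ => abs_nonneg _) (Finset.mem_range.mpr (by omega : k < N+1)))
  exact Finset.single_le_sum (f := fun n => |C k n|)
    (fun i _ => abs_nonneg _) (Finset.mem_range.mpr (by omega : n < N+1))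

theorem L4 {d : ℕ} {u : ℝ × (Fin d → ℝ) → ℂ} {F : ℝ → 𝓢(Fin d → ℝ, ℂ)} (h : IsSol d u F)
    {t r a : ℝ} (hr : 0 < r) (hO : Metric.ball t r ⊆ OO d u) (ha : |a - t| ≤ r) : Geq d u t a := by
  obtain ⟨N, C, hC, hL⟩ := L3a d
  obtain ⟨M, hM⟩ := sch_bd d N (F t)
  have hB : ∀ s ∈ Metric.ball t r, ∀ q, ‖u (s, q)‖ ≤ C * M := fun s hs q =>
    (hL u F h s t M (by positivity) (fun ε hε q0 => GG_const h hO (Metric.mem_ball_self hr) hs hε s q0)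
      hM q).1
  intro ε hε q0
  have h1 := GG_cont h hB hε t q0 a
  have hcl : a ∈ closure (Metric.ball t r) := by
    rw [closure_ball t hr.ne', Metric.mem_closedBall, Real.dist_eq]; exact ha
  have : (𝓝[Metric.ball t r] a).NeBot := mem_closure_iff_nhdsWithin_neBot.mp hcl
  refine tendsto_nhds_unique h1 (tendsto_const_nhds.congr' ?_)
  filter_upwards [self_mem_nhdsWithin] with s hs
  exact GG_const h hO (Metric.mem_ball_self hr) hs hε t q0

end Part6

section Part7
open MeasureTheory Filter Topology
open scoped SchwartzMap FourierTransform LineDeriv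

theorem iter_slice {d : ℕ} {u : ℝ × (Fin d → ℝ) → ℂ} {F : ℝ → 𝓢(Fin d → ℝ, ℂ)} (h : IsSol d u F)
    (n : ℕ) (x : Fin d → ℝ) : Continuous fun t => iteratedFDeriv ℝ n (F t) x := by
  have e : ∀ t, iteratedFDeriv ℝ n (F t) x =
      (iteratedFDeriv ℝ n u (t, x)).compContinuousLinearMap
        (fun _ => ContinuousLinearMap.inr ℝ ℝ (Fin d → ℝ)) := by
    intro t
    have h1 : (F t : (Fin d → ℝ) → ℂ) = (fun p => u ((t, 0) + p)) ∘ (ContinuousLinearMap.inr ℝ ℝ (Fin d → ℝ)) := by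
      ext q
      simp [h.slice]
    have h2 : ContDiff ℝ (⊤ : ℕ∞) (fun p => u ((t, 0) + p)) := h.smooth.comp (contDiff_const.add contDiff_id)
    rw [h1, ContinuousLinearMap.iteratedFDeriv_comp_right _ h2 _ (by exact_mod_cast le_top),
      iteratedFDeriv_comp_add_left]
    simp
  simp_rw [e]
  have c1 : Continuous (iteratedFDeriv ℝ n u) := h.smooth.continuous_iteratedFDeriv (by exact_mod_cast le_top)
  have c2 : Continuous fun t : ℝ => iteratedFDeriv ℝ n u (t, x) := by fun_prop
  exact (ContinuousMultilinearMap.compContinuousLinearMapL (F := ℂ)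
    (fun _ : Fin n => ContinuousLinearMap.inr ℝ ℝ (Fin d → ℝ))).continuous.comp c2

theorem OO_univ {d : ℕ} {u : ℝ × (Fin d → ℝ) → ℂ} {F : ℝ → 𝓢(Fin d → ℝ, ℂ)} (h : IsSol d u F) :
    OO d u = Set.univ := by
  by_contra hne
  set K := (OO d u)ᶜ with hK
  have hKc : IsClosed K := (OO_open d u).isClosed_compl
  have hKne : K.Nonempty := Set.nonempty_compl.mpr hne
  obtain ⟨N, C, hC, hL⟩ := L3a d
  let S : ℕ → Set K := fun M => {t : K | ∀ k ≤ N, ∀ n ≤ N, ∀ x, ‖x‖ ^ k * ‖iteratedFDeriv ℝ n (F t) x‖ ≤ M}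
  have hS : ∀ M, IsClosed (S M) := by
    intro M
    simp only [S, Set.ofPred_forall]
    refine isClosed_iInter fun k => isClosed_iInter fun _ => isClosed_iInter fun n =>
      isClosed_iInter fun _ => isClosed_iInter fun x => isClosed_le ?_ continuous_const
    exact continuous_const.mul ((iter_slice h n x).comp continuous_subtype_val).norm
  have hU : ⋃ M, S M = Set.univ := by
    refine Set.eq_univ_of_forall fun t => ?_
    obtain ⟨M, hM⟩ := sch_bd d N (F t)
    exact Set.mem_iUnion.mpr ⟨M, hM⟩
  have : CompleteSpace K := hKc.completeSpace_coe
  have : Nonempty K := hKne.to_subtype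
  obtain ⟨M, t0, ht0⟩ := nonempty_interior_of_iUnion_of_closed hS hU
  rw [mem_interior_iff_mem_nhds, Metric.mem_nhds_iff] at ht0
  obtain ⟨δ, hδ, hball⟩ := ht0
  have hM : ∀ a ∈ K, |a - t0| < δ →
      ∀ k ≤ N, ∀ n ≤ N, ∀ x, ‖x‖ ^ k * ‖iteratedFDeriv ℝ n (F a) x‖ ≤ M := by
    intro a ha hd
    have hm : (⟨a, ha⟩ : K) ∈ S M := by
      apply hball
      rw [Metric.mem_ball, Subtype.dist_eq, Real.dist_eq]
      exact hd
    exact hm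
  apply t0.2
  refine ⟨δ / 2, by positivity, C * M, fun t ht q => ?_⟩
  rw [Metric.mem_ball, Real.dist_eq] at ht
  by_cases htK : t ∈ K
  · exact hL u F h t t M (by positivity) (Geq_refl d u t) (hM t htK (by linarith)) q
  · obtain ⟨a, ha, hda⟩ := hKc.exists_infDist_eq_dist hKne t
    have h1 : dist t a ≤ dist t t0 := by
      rw [← hda]; exact Metric.infDist_le_dist_of_mem t0.2
    have hpos : 0 < dist t a := dist_pos.mpr (by rintro rfl; exact htK ha)
    have hg : Geq d u t a := by
      refine L4 h hpos ?_ (by rw [Real.dist_eq, abs_sub_comm])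
      intro s hs
      by_contra hsO
      have := Metric.infDist_le_dist_of_mem (x := t) (show s ∈ K from hsO)
      rw [Metric.mem_ball, dist_comm] at hs
      linarith
    refine hL u F h t a M (by positivity) hg (hM a ha ?_) q
    rw [Real.dist_eq, Real.dist_eq, abs_sub_comm t a] at h1
    have := abs_sub_le a t t0
    linarith

theorem disp {d : ℕ} {u : ℝ × (Fin d → ℝ) → ℂ} {F : ℝ → 𝓢(Fin d → ℝ, ℂ)} (h : IsSol d u F)
    {t s : ℝ} (hts : s ≠ t ∨ d = 0) (q0 : Fin d → ℝ) :
    ‖u (t, q0)‖ * ‖∫ x, KK d 1 x‖ ≤ (Real.pi / |s - t|) ^ ((d : ℝ) / 2) * ∫ q, ‖u (s, q)‖ :=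
  L3b h (L4 h (r := |s - t| + 1) (by positivity) (by rw [OO_univ h]; exact Set.subset_univ _)
    (by linarith)) hts q0

end Part7

section Part8
open MeasureTheory Filter Topology
open scoped SchwartzMap FourierTransform LineDeriv

theorem L2sq (d : ℕ) (f : 𝓢(Fin d → ℝ, ℂ)) :
    Integrable (fun q => ‖f q‖ ^ 2) ∧ (eLpNorm f 2 volume).toReal ^ 2 = ∫ q, ‖f q‖ ^ 2 := by
  have hm : MemLp f 2 volume := f.memLp 2 volume
  refine ⟨(memLp_two_iff_integrable_sq_norm hm.1).mp hm, ?_⟩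
  have h0 : 0 ≤ ∫ q, ‖f q‖ ^ 2 := integral_nonneg fun q => by positivity
  rw [hm.eLpNorm_eq_integral_rpow_norm (by norm_num) (by norm_num)]
  simp only [ENNReal.toReal_ofNat, Real.rpow_ofNat]
  rw [ENNReal.toReal_ofReal (by positivity), ← Real.rpow_natCast, ← Real.rpow_mul h0]
  norm_num

theorem wt (d : ℕ) (j : Fin d) (f : 𝓢(Fin d → ℝ, ℂ)) :
    ∃ g : 𝓢(Fin d → ℝ, ℂ), ∀ q, g q = ((q j ^ d : ℝ) : ℂ) * f q := by
  have h1 : (fun q : Fin d → ℝ => q j).HasTemperateGrowth :=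
    (ContinuousLinearMap.proj (R := ℝ) (φ := fun _ : Fin d => ℝ) j).hasTemperateGrowth
  have h2 : (fun q : Fin d → ℝ => q j ^ d).HasTemperateGrowth := h1.pow d
  refine ⟨SchwartzMap.smulLeftCLM ℂ (fun q : Fin d → ℝ => q j ^ d) f, fun q => ?_⟩
  rw [SchwartzMap.smulLeftCLM_apply_apply h2]
  simp

theorem W_int (d : ℕ) (hd : 0 < d) :
    Integrable (fun q : Fin d → ℝ => (1 + ∑ j, (q j ^ d) ^ 2)⁻¹) := by
  have : Nonempty (Fin d) := ⟨⟨0, hd⟩⟩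
  have h1 : Integrable (fun x : Fin d → ℝ => (1 + ‖x‖) ^ (-((2 * d : ℕ) : ℝ))) :=
    integrable_one_add_norm (by
      simp only [Module.finrank_fintype_fun_eq_card, Fintype.card_fin]
      exact_mod_cast (by omega))
  have hp : ∀ q : Fin d → ℝ, 0 < 1 + ∑ j, (q j ^ d) ^ 2 := fun q =>
    add_pos_of_pos_of_nonneg one_pos (Finset.sum_nonneg fun j _ => sq_nonneg _)
  refine (h1.const_mul (2 ^ (2 * d - 1))).mono' ?_ (Eventually.of_forall fun q => ?_)
  · refine Continuous.aestronglyMeasurable ?_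
    refine Continuous.inv₀ (by fun_prop) fun q => (hp q).ne'
  · rw [Real.norm_of_nonneg (inv_nonneg.mpr (hp q).le), Real.rpow_neg (by positivity), Real.rpow_natCast]
    obtain ⟨j, hj⟩ := Finite.exists_max fun j => ‖q j‖
    have h2 : ‖q‖ ≤ ‖q j‖ := (pi_norm_le_iff_of_nonneg (norm_nonneg _)).mpr hj
    have h3 : (1 + ‖q‖) ^ (2 * d) ≤ 2 ^ (2 * d - 1) * (1 + ∑ j, (q j ^ d) ^ 2) := by
      refine (add_pow_le zero_le_one (norm_nonneg q) _).trans ?_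
      rw [one_pow]
      gcongr
      calc ‖q‖ ^ (2 * d) ≤ ‖q j‖ ^ (2 * d) := by gcongr
        _ = (q j ^ d) ^ 2 := by
          rw [Real.norm_eq_abs, ← pow_mul, mul_comm d 2, Even.pow_abs ⟨d, by ring⟩]
        _ ≤ _ := Finset.single_le_sum (f := fun j => (q j ^ d) ^ 2) (fun i _ => sq_nonneg _) (Finset.mem_univ j)
    rw [inv_le_comm₀ (hp q) (by positivity), mul_inv, inv_inv, inv_mul_le_iff₀ (by positivity)]
    exact h3

theorem amgm {X I J : ℝ} (hX : 0 ≤ X) (hI : 0 ≤ I) (hJ : 0 ≤ J)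
    (h : ∀ s > 0, 2 * X ≤ s * I + J / s) : X ^ 2 ≤ I * J := by
  rcases hX.eq_or_lt with h0 | h0
  · rw [← h0]; have := mul_nonneg hI hJ; simpa
  rcases hI.eq_or_lt with h1 | h1
  · exfalso
    have := h ((J + 1) / X) (by positivity)
    rw [← h1] at this
    have h2 : J / ((J + 1) / X) ≤ X := by
      rw [div_div_eq_mul_div, div_le_iff₀ (by positivity)]
      nlinarith
    linarith
  · have := h (X / I) (by positivity)
    rw [div_mul_cancel₀ _ h1.ne', div_div_eq_mul_div] at this
    have h3 : X ≤ J * I / X := by linarith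
    rw [le_div_iff₀ h0] at h3
    nlinarith

theorem opt (d : ℕ) (hd : 0 < d) {X c A Q S : ℝ} (hc0 : 0 ≤ c) (hA0 : 0 ≤ A) (hS0 : 0 ≤ S)
    (hBS : Q ≤ S ^ 2)
    (key : ∀ l : ℝ, 0 < l → X ^ 2 ≤ ((l ^ d)⁻¹ * c) * (A ^ 2 + (l ^ d) ^ 2 * Q)) :
    X ^ 2 ≤ 2 * (c + 1) * (A * S) := by
  have key2 : ∀ δ > 0, X ^ 2 ≤ 2 * (c + 1) * ((A + δ) * (S + δ)) := by
    intro δ hδ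
    set μ := (A + δ) / (S + δ) with hμ
    have hμ0 : 0 < μ := by positivity
    have hl : (μ ^ ((d : ℝ)⁻¹)) ^ d = μ := Real.rpow_inv_natCast_pow hμ0.le hd.ne'
    have := key (μ ^ ((d : ℝ)⁻¹)) (by positivity)
    rw [hl] at this
    refine this.trans ?_
    have hq : Q ≤ (S + δ) ^ 2 := hBS.trans (by gcongr; linarith)
    calc μ⁻¹ * c * (A ^ 2 + μ ^ 2 * Q)
        ≤ μ⁻¹ * c * ((A + δ) ^ 2 + μ ^ 2 * (S + δ) ^ 2) := by
          gcongr
          linarith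
      _ ≤ μ⁻¹ * (c + 1) * ((A + δ) ^ 2 + μ ^ 2 * (S + δ) ^ 2) := by
          gcongr
          linarith
      _ = _ := by
          rw [hμ]; field_simp; ring
  have ht : Tendsto (fun δ : ℝ => 2 * (c + 1) * ((A + δ) * (S + δ))) (𝓝[>] 0) (𝓝 (2 * (c + 1) * (A * S))) := by
    have : Continuous (fun δ : ℝ => 2 * (c + 1) * ((A + δ) * (S + δ))) := by fun_prop
    have h := this.tendsto 0
    simp only [add_zero] at h
    exact h.mono_left nhdsWithin_le_nhds
  refine ge_of_tendsto ht ?_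
  filter_upwards [self_mem_nhdsWithin] with δ hδ using key2 δ hδ

set_option maxHeartbeats 1000000 in
theorem static (d : ℕ) (hd : 0 < d) : ∃ C : ℝ, 0 < C ∧ ∀ f : 𝓢(Fin d → ℝ, ℂ),
    (∫ q, ‖f q‖) ^ 2 ≤ C * ((eLpNorm f 2 volume).toReal *
      ∑ j : Fin d, (eLpNorm (fun q : Fin d → ℝ => ((q j ^ d : ℝ) : ℂ) * f q) 2 volume).toReal) := by
  set c := ∫ q : Fin d → ℝ, (1 + ∑ j, (q j ^ d) ^ 2)⁻¹ with hc
  have hp : ∀ q : Fin d → ℝ, 0 < 1 + ∑ j, (q j ^ d) ^ 2 := fun q =>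
    add_pos_of_pos_of_nonneg one_pos (Finset.sum_nonneg fun j _ => sq_nonneg _)
  have hc0 : 0 ≤ c := integral_nonneg fun q => inv_nonneg.mpr (hp q).le
  refine ⟨2 * (c + 1), by positivity, fun f => ?_⟩
  choose g hg using fun j => wt d j f
  have hge : ∀ j, (fun q : Fin d → ℝ => ((q j ^ d : ℝ) : ℂ) * f q) = g j := fun j => by
    ext q; exact (hg j q).symm
  simp_rw [hge]
  set A := (eLpNorm f 2 volume).toReal with hA
  set B := fun j => (eLpNorm (g j) 2 volume).toReal with hB
  have hA0 : 0 ≤ A := ENNReal.toReal_nonneg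
  have hB0 : ∀ j, 0 ≤ B j := fun j => ENNReal.toReal_nonneg
  obtain ⟨iA, eA⟩ := L2sq d f
  have iB := fun j => (L2sq d (g j)).1
  have eB : ∀ j, B j ^ 2 = _ := fun j => (L2sq d (g j)).2
  set X := ∫ q, ‖f q‖ with hX
  have hX0 : 0 ≤ X := integral_nonneg fun q => norm_nonneg _
  have key : ∀ l : ℝ, 0 < l → X ^ 2 ≤ ((l ^ d)⁻¹ * c) * (A ^ 2 + (l ^ d) ^ 2 * ∑ j, B j ^ 2) := by
    intro l hl
    have hB2 : 0 ≤ ∑ j, B j ^ 2 := Finset.sum_nonneg fun j _ => sq_nonneg _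
    refine amgm hX0 (mul_nonneg (inv_nonneg.mpr (pow_nonneg hl.le _)) hc0)
      (add_nonneg (sq_nonneg _) (mul_nonneg (sq_nonneg _) hB2)) fun s hs => ?_
    have i1 : Integrable fun q : Fin d → ℝ => (1 + ∑ j, ((l • q) j ^ d) ^ 2)⁻¹ :=
      (W_int d hd).comp_smul hl.ne'
    have e1 : ∫ q : Fin d → ℝ, (1 + ∑ j, ((l • q) j ^ d) ^ 2)⁻¹ = (l ^ d)⁻¹ * c := by
      rw [Measure.integral_comp_smul volume (fun q : Fin d → ℝ => (1 + ∑ j, (q j ^ d) ^ 2)⁻¹) l]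
      simp only [Module.finrank_fintype_fun_eq_card, Fintype.card_fin, smul_eq_mul]
      rw [abs_of_nonneg (by positivity)]
    have i2 : Integrable fun q => ∑ j, ‖g j q‖ ^ 2 := integrable_finsetSum _ fun j _ => iB j
    have i3 : Integrable fun q => ‖f q‖ ^ 2 + (l ^ d) ^ 2 * ∑ j, ‖g j q‖ ^ 2 := iA.add (i2.const_mul _)
    have e3 : ∫ q, (‖f q‖ ^ 2 + (l ^ d) ^ 2 * ∑ j, ‖g j q‖ ^ 2) = A ^ 2 + (l ^ d) ^ 2 * ∑ j, B j ^ 2 := by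
      rw [integral_add iA (i2.const_mul _), integral_const_mul, integral_finsetSum _ fun j _ => iB j, eA]
      simp_rw [eB]
    rw [← e1, ← e3, ← integral_const_mul, ← integral_div, ← integral_const_mul,
      ← integral_add (i1.const_mul _) (i3.div_const _)]
    refine integral_mono (f.integrable.norm.const_mul _) ((i1.const_mul _).add (i3.div_const _)) fun q => ?_
    simp only [Pi.add_apply]
    have e4 : ‖f q‖ ^ 2 + (l ^ d) ^ 2 * ∑ j, ‖g j q‖ ^ 2 = (1 + ∑ j, ((l • q) j ^ d) ^ 2) * ‖f q‖ ^ 2 := by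
      rw [add_mul, one_mul, Finset.mul_sum, Finset.sum_mul]
      congr 1
      refine Finset.sum_congr rfl fun j _ => ?_
      rw [hg, norm_mul, Complex.norm_real, mul_pow, Real.norm_eq_abs, sq_abs, Pi.smul_apply, smul_eq_mul,
        mul_pow]
      ring
    rw [e4]
    have hw := hp (l • q)
    set w := 1 + ∑ j, ((l • q) j ^ d) ^ 2
    have e5 : s * w⁻¹ + w * ‖f q‖ ^ 2 / s - 2 * ‖f q‖ = (s * w) * (w⁻¹ - ‖f q‖ / s) ^ 2 := by
      field_simp
      ring
    have : 0 ≤ (s * w) * (w⁻¹ - ‖f q‖ / s) ^ 2 := by positivity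
    linarith
  exact opt d hd hc0 hA0 (Finset.sum_nonneg fun j _ => hB0 j)
    (Finset.sum_sq_le_sq_sum_of_nonneg fun j _ => hB0 j) key

end Part8

section Part9
open MeasureTheory Filter Topology
open scoped SchwartzMap FourierTransform LineDeriv

theorem idx_finite (d : ℕ) : Finite {ab : (Fin d → ℕ) × (Fin d → ℕ) //
    (∑ i, ab.1 i) + (∑ i, ab.2 i) = d} := by
  refine (((Set.finite_Icc (0 : Fin d → ℕ) (fun _ => d)).prod (Set.finite_Icc (0 : Fin d → ℕ) (fun _ => d))).subset ?_).to_subtype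
  rintro ⟨a, b⟩ h
  have h' : (∑ i, a i) + (∑ i, b i) = d := h
  refine ⟨⟨fun i => Nat.zero_le _, fun i => ?_⟩, fun i => Nat.zero_le _, fun i => ?_⟩
  · have := Finset.single_le_sum (f := a) (fun i _ => Nat.zero_le _) (Finset.mem_univ i)
    show a i ≤ d
    omega
  · have := Finset.single_le_sum (f := b) (fun i _ => Nat.zero_le _) (Finset.mem_univ i)
    show b i ≤ d
    omega

theorem static_tsum (d : ℕ) : ∃ C : ℝ, 0 < C ∧ ∀ f : 𝓢(Fin d → ℝ, ℂ),
    (∫ q, ‖f q‖) ^ 2 ≤ C * ∑' ab : {ab : (Fin d → ℕ) × (Fin d → ℕ) //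
                  (∑ i, ab.1 i) + (∑ i, ab.2 i) = d},
                (eLpNorm (fun q : Fin d → ℝ =>
                    ((∏ i, q i ^ ab.1.1 i : ℝ) : ℂ) * f q) 2 volume).toReal
                  * (eLpNorm (fun q : Fin d → ℝ =>
                    ((∏ i, q i ^ ab.1.2 i : ℝ) : ℂ) * f q) 2 volume).toReal := by
  have hfin := idx_finite d
  rcases Nat.eq_zero_or_pos d with hd | hd
  · subst hd
    refine ⟨1, one_pos, fun f => ?_⟩
    rw [one_mul]
    refine le_trans ?_ (Summable.le_tsum (Summable.of_finite) ⟨(0, 0), by simp⟩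
      fun _ _ => mul_nonneg ENNReal.toReal_nonneg ENNReal.toReal_nonneg)
    simp only [Finset.univ_eq_empty, Finset.prod_empty, Complex.ofReal_one, one_mul]
    rw [← sq]
    have := (L2sq 0 f).2
    rw [show (fun q => f q) = (f : (Fin 0 → ℝ) → ℂ) from rfl, this]
    have hv : (volume : Measure (Fin 0 → ℝ)) = Measure.dirac 0 := by
      rw [volume_pi, Measure.pi_of_empty]
      congr 1
      exact Subsingleton.elim _ _
    rw [hv, integral_dirac, integral_dirac]
  · obtain ⟨C, hC, h⟩ := static d hd
    refine ⟨C * d, by positivity, fun f => (h f).trans ?_⟩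
    rw [mul_assoc]
    refine mul_le_mul_of_nonneg_left ?_ hC.le
    rw [Finset.mul_sum]
    refine le_of_le_of_eq (Finset.sum_le_card_nsmul Finset.univ _ (∑' _, _) fun j _ => ?_)
      (by rw [Finset.card_univ, Fintype.card_fin, nsmul_eq_mul])
    · refine le_trans ?_ (Summable.le_tsum (Summable.of_finite) ⟨(0, Pi.single j d), by simp⟩
        fun _ _ => mul_nonneg ENNReal.toReal_nonneg ENNReal.toReal_nonneg)
      have e : ∀ q : Fin d → ℝ, ∏ i, q i ^ (Pi.single j d : Fin d → ℕ) i = q j ^ d := fun q => by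
        rw [Finset.prod_eq_single j]
        · simp
        · intro i _ hij; simp [Pi.single_eq_of_ne hij]
        · simp
      simp only [e, Pi.zero_apply, pow_zero, Finset.prod_const_one, Complex.ofReal_one, one_mul]
      exact le_rfl

theorem final (d : ℕ) :
    ∃ C : ℝ, 0 < C ∧
      ∀ u : ℝ × (Fin d → ℝ) → ℂ, ContDiff ℝ (⊤ : ℕ∞) u →
        (∀ t : ℝ, ∃ f : SchwartzMap (Fin d → ℝ) ℂ, ∀ q, u (t, q) = f q) →
        (∀ x : ℝ × (Fin d → ℝ),
          dt d u x + Complex.I * ∑ j : Fin d, dq d j (dq d j u) x = 0) →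
        ∀ t : ℝ,
          |t| ^ d * (⨆ q : Fin d → ℝ, ‖u (t, q)‖) ^ 2
            ≤ C * ∑' ab : {ab : (Fin d → ℕ) × (Fin d → ℕ) //
                  (∑ i, ab.1 i) + (∑ i, ab.2 i) = d},
                (eLpNorm (fun q : Fin d → ℝ =>
                    ((∏ i, q i ^ ab.1.1 i : ℝ) : ℂ) * u (0, q)) 2 volume).toReal
                  * (eLpNorm (fun q : Fin d → ℝ =>
                    ((∏ i, q i ^ ab.1.2 i : ℝ) : ℂ) * u (0, q)) 2 volume).toReal := by
  obtain ⟨C, hC, hst⟩ := static_tsum d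
  have hcp : 0 < ‖∫ x, KK d 1 x‖ := norm_pos_iff.mpr (KK_one_int_ne d)
  set c := ‖∫ x, KK d 1 x‖ with hc
  clear_value c
  have hpi := Real.pi_pos
  refine ⟨Real.pi ^ d / c ^ 2 * C, by positivity, ?_⟩
  intro u hu hsl hpde t
  choose F hF using hsl
  have h : IsSol d u F := ⟨hu, hF, hpde⟩
  have h0 := hst (F 0)
  simp_rw [← hF 0] at h0
  rw [mul_assoc]
  refine le_trans ?_ (mul_le_mul_of_nonneg_left h0 (by positivity))
  by_cases hts : (0 : ℝ) ≠ t ∨ d = 0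
  · have hX : 0 ≤ ∫ q, ‖u (0, q)‖ := integral_nonneg fun q => norm_nonneg _
    have hdis := disp h hts
    set X := ∫ q, ‖u (0, q)‖ with hXd
    clear_value X
    rw [zero_sub, abs_neg, ← hc] at hdis
    have hsup : (⨆ q : Fin d → ℝ, ‖u (t, q)‖) ≤ (Real.pi / |t|) ^ ((d : ℝ) / 2) * X / c :=
      ciSup_le fun q => by rw [le_div_iff₀ hcp]; exact hdis q
    have hs0 : 0 ≤ (⨆ q : Fin d → ℝ, ‖u (t, q)‖) := Real.iSup_nonneg fun q => norm_nonneg _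
    have hp2 : ((Real.pi / |t|) ^ ((d : ℝ) / 2)) ^ 2 = (Real.pi / |t|) ^ d := by
      rw [← Real.rpow_natCast, ← Real.rpow_mul (by positivity), ← Real.rpow_natCast]
      congr 1
      push_cast
      ring
    calc |t| ^ d * (⨆ q : Fin d → ℝ, ‖u (t, q)‖) ^ 2
        ≤ |t| ^ d * ((Real.pi / |t|) ^ ((d : ℝ) / 2) * X / c) ^ 2 := by gcongr
      _ = (|t| ^ d * (Real.pi / |t|) ^ d) * X ^ 2 / c ^ 2 := by rw [div_pow, mul_pow, hp2]; ring
      _ = Real.pi ^ d * X ^ 2 / c ^ 2 := by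
        rcases hts with hts | hd
        · have : |t| ≠ 0 := abs_ne_zero.mpr hts.symm
          rw [← mul_pow, mul_div_cancel₀ _ this]
        · subst hd; simp
      _ ≤ _ := by rw [mul_div_right_comm]
  · push Not at hts
    obtain ⟨ht, hd⟩ := hts
    rw [← ht, abs_zero, zero_pow hd, zero_mul]
    positivity

end Part9

end Helpers

/-- Dispersive estimate for the Schrödinger equation with weighted data:
|t|^d ‖u(t,·)‖²_{L^∞} ≤ C Σ_{|α|+|β|=d} ‖q^α u(0,·)‖_{L²} ‖q^β u(0,·)‖_{L²}. -/
theorem stmt13 (d : ℕ) :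
    ∃ C : ℝ, 0 < C ∧
      ∀ u : ℝ × (Fin d → ℝ) → ℂ, ContDiff ℝ (⊤ : ℕ∞) u →
        (∀ t : ℝ, ∃ f : SchwartzMap (Fin d → ℝ) ℂ, ∀ q, u (t, q) = f q) →
        (∀ x : ℝ × (Fin d → ℝ),
          dt d u x + Complex.I * ∑ j : Fin d, dq d j (dq d j u) x = 0) →
        ∀ t : ℝ,
          |t| ^ d * (⨆ q : Fin d → ℝ, ‖u (t, q)‖) ^ 2
            ≤ C * ∑' ab : {ab : (Fin d → ℕ) × (Fin d → ℕ) //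
                  (∑ i, ab.1 i) + (∑ i, ab.2 i) = d},
                (eLpNorm (fun q : Fin d → ℝ =>
                    ((∏ i, q i ^ ab.1.1 i : ℝ) : ℂ) * u (0, q)) 2 volume).toReal
                  * (eLpNorm (fun q : Fin d → ℝ =>
                    ((∏ i, q i ^ ab.1.2 i : ℝ) : ℂ) * u (0, q)) 2 volume).toReal := by
  exact final d
end
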